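/- Let ω ⊂ ℝ^d be an open, bounded domain and k ≥ 1; denote s = d(d+1)/k, or s = 1 when k ≥ d(d+1). Let S ∈ C^∞(ω̄, ℝ^{(d+k)×(d+k)}_sym), let γ > 0, and for h > 0 set Ω^h = {(x,z) : x ∈ ω, z ∈ B(0,h) ⊂ ℝ^k} ⊂ ℝ^{d+k} and g^h = Id_{d+k} + 2h^{γ/2}S. Let W : ℝ^{(d+k)×(d+k)} → [0,∞] be C²-regular in a neighborhood of SO(d+k), with W(Id_{d+k}) = 0 and W(RF) = W(F) for all R ∈ SO(d+k). Define E^h(u) = ⨍_{Ω^h} W((∇u)(g^h)^{−1/2}) d(x,z). Then: (i) if γ ≥ 4, then for every β < 2 + γ/2 there is a constant C and, for all sufficiently small h > 0, a smooth map u^h : Ω^h → ℝ^{d+k} with E^h(u^h) ≤ C h^β; (ii) if 4/(3+s) ≤ γ < 4, the same holds for every β < (4 + γ(1+s))/(2+s); (iii) if 0 < γ < 4/(3+s), the same holds with β = 2γ. In particular, inf E^h ≤ C h^β in each regime. -/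

import Mathlib

noncomputable section
open MeasureTheory Real
open scoped BigOperators ENNReal NNReal

/-- Partial derivative of `f` in the `i`-th coordinate direction. -/
def pd {d : ℕ} {E : Type*} [NormedAddCommGroup E] [NormedSpace ℝ E]
    (i : Fin d) (f : (Fin d → ℝ) → E) (x : Fin d → ℝ) : E :=
  fderiv ℝ f x (Pi.single i 1)

/-- Square-matrix product (for matrices presented as functions). -/
def matMul {n : ℕ} (F G : Fin n → Fin n → ℝ) : Fin n → Fin n → ℝ :=
  fun i j => ∑ l, F i l * G l j

/-- The identity matrix. -/
def matId {n : ℕ} : Fin n → Fin n → ℝ :=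
  fun i j => if i = j then 1 else 0

/-- The Jacobian matrix `∇u = [∂ⱼuⁱ]` of a map `u : ℝⁿ → ℝⁿ`. -/
def matJac {n : ℕ} (u : (Fin n → ℝ) → Fin n → ℝ) (p : Fin n → ℝ) :
    Fin n → Fin n → ℝ :=
  fun i j => pd j (fun y => u y i) p

/-- A matrix is symmetric positive definite. -/
def PosDefFun {n : ℕ} (M : Fin n → Fin n → ℝ) : Prop :=
  (∀ i j, M i j = M j i) ∧
  ∀ ξ : Fin n → ℝ, ξ ≠ 0 → 0 < ∑ i, ∑ j, M i j * ξ i * ξ j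

/-- The special orthogonal group `SO(n)` (matrices as functions). -/
def SOset (n : ℕ) : Set (Fin n → Fin n → ℝ) :=
  {R | matMul R (fun i j => R j i) = matId ∧ (Matrix.of R).det = 1}

/-- The first `d` coordinates of a point of `ℝ^{d+k}`. -/
def xpart {d k : ℕ} (p : Fin (d + k) → ℝ) : Fin d → ℝ :=
  fun i => p (Fin.castAdd k i)

/-- The last `k` coordinates of a point of `ℝ^{d+k}`. -/
def zpart {d k : ℕ} (p : Fin (d + k) → ℝ) : Fin k → ℝ :=
  fun j => p (Fin.natAdd d j)

/-- The thin film `Ω^h = ω × B(0,h) ⊂ ℝ^{d+k}`. -/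
def thinFilm {d k : ℕ} (ω : Set (Fin d → ℝ)) (h : ℝ) : Set (Fin (d + k) → ℝ) :=
  {p | xpart p ∈ ω ∧ ∑ j, zpart p j ^ 2 < h ^ 2}

/-- The prestrain metric `g^h = Id_{d+k} + 2h^{γ/2}S`. -/
def prestrain {d k : ℕ} (S : (Fin d → ℝ) → Fin (d + k) → Fin (d + k) → ℝ)
    (γ h : ℝ) (x : Fin d → ℝ) : Fin (d + k) → Fin (d + k) → ℝ :=
  fun i j => matId i j + 2 * h ^ (γ / 2) * S x i j

/-- `R` is the matrix field `(g^h)^{-1/2}` on `ω̄`: at every point it is the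
(unique) symmetric positive definite matrix with `R·R·g^h = Id`. -/
def IsInvSqrt {d k : ℕ} (ω : Set (Fin d → ℝ))
    (S : (Fin d → ℝ) → Fin (d + k) → Fin (d + k) → ℝ) (γ h : ℝ)
    (R : (Fin d → ℝ) → Fin (d + k) → Fin (d + k) → ℝ) : Prop :=
  ∀ x ∈ closure ω, PosDefFun (R x) ∧
    matMul (matMul (R x) (R x)) (prestrain S γ h x) = matId

/-- The energy `E^h(u) = ⨍_{Ω^h} W((∇u)(g^h)^{-1/2})`, as an average lower
integral with respect to the Lebesgue measure on `Ω^h`. -/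
def energy {d k : ℕ} (ω : Set (Fin d → ℝ)) (h : ℝ)
    (W : (Fin (d + k) → Fin (d + k) → ℝ) → ℝ≥0∞)
    (u : (Fin (d + k) → ℝ) → Fin (d + k) → ℝ)
    (R : (Fin d → ℝ) → Fin (d + k) → Fin (d + k) → ℝ) : ℝ≥0∞ :=
  (volume (thinFilm ω h (k := k)))⁻¹ *
    ∫⁻ p in thinFilm ω h (k := k), W (matMul (matJac u p) (R (xpart p)))

theorem matMul_eq_mul {n : ℕ} (F G : Fin n → Fin n → ℝ) :
    Matrix.of (matMul F G) = Matrix.of F * Matrix.of G := by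
  ext i j
  simp [matMul, Matrix.mul_apply]

theorem matId_eq_one {n : ℕ} : Matrix.of (matId : Fin n → Fin n → ℝ) = 1 := by
  ext i j
  simp [matId, Matrix.one_apply]

theorem posDefFun_iff {n : ℕ} (M : Fin n → Fin n → ℝ) :
    PosDefFun M ↔ (Matrix.of M).PosDef := by
  have key : ∀ x : Fin n → ℝ, star x ⬝ᵥ (Matrix.of M).mulVec x
      = ∑ i, ∑ j, M i j * x i * x j := by
    intro x
    simp only [dotProduct, Matrix.mulVec, Finset.mul_sum, Pi.star_apply, star_trivial,
      Matrix.of_apply]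
    refine Finset.sum_congr rfl fun i _ => Finset.sum_congr rfl fun j _ => by ring
  rw [Matrix.posDef_iff_dotProduct_mulVec]
  constructor
  · rintro ⟨hs, hp⟩
    refine ⟨by ext i j; simp [hs j i], fun {x} hx => ?_⟩
    rw [key]
    exact hp x hx
  · rintro ⟨hs, hp⟩
    refine ⟨fun i j => by simpa using congrFun (congrFun hs j) i, fun x hx => ?_⟩
    rw [← key]
    exact hp hx

section MatrixRoot

open scoped MatrixOrder Matrix.Norms.L2Operator

theorem exists_posDef_sqrt {n : ℕ} {A : Matrix (Fin n) (Fin n) ℝ} (hA : A.PosDef) :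
    ∃ K : Matrix (Fin n) (Fin n) ℝ, K.PosDef ∧ K * K = A := by
  have hA' : 0 ≤ A := hA.posSemidef.nonneg
  refine ⟨CFC.sqrt A, ?_, CFC.sqrt_mul_sqrt_self A hA'⟩
  have hs : (CFC.sqrt A).PosSemidef := Matrix.nonneg_iff_posSemidef.1 (CFC.sqrt_nonneg A)
  rw [hs.posDef_iff_det_ne_zero]
  intro h0
  have := congrArg Matrix.det (CFC.sqrt_mul_sqrt_self A hA')
  rw [Matrix.det_mul, h0, zero_mul] at this
  exact hA.det_pos.ne this

end MatrixRoot

theorem sum_sq_sub_one_le {n : ℕ} {K : Matrix (Fin n) (Fin n) ℝ} (hK : K.PosDef) :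
    ∑ i, ∑ j, (K - 1) i j ^ 2 ≤ ∑ i, ∑ j, (K * K - 1) i j ^ 2 := by
  have hKt : K.transpose = K := by simpa using hK.isHermitian.eq
  have hsum : ∀ M : Matrix (Fin n) (Fin n) ℝ,
      ∑ i, ∑ j, M i j ^ 2 = (M.transpose * M).trace := by
    intro M
    rw [Finset.sum_comm]
    simp [Matrix.trace, Matrix.mul_apply, sq]
  rw [hsum, hsum]
  set B := K - 1 with hB
  have hBt : B.transpose = B := by rw [hB, Matrix.transpose_sub, hKt, Matrix.transpose_one]
  have h1 : (K * K - 1).transpose = K * K - 1 := by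
    rw [Matrix.transpose_sub, Matrix.transpose_mul, hKt, Matrix.transpose_one]
  have h2 : (K * K - 1) * (K * K - 1)
      = B.transpose * B + (2 : ℝ) • (B.transpose * K * B) + (K * B).transpose * (K * B) := by
    rw [Matrix.transpose_mul, hKt, hBt, hB, two_smul]
    noncomm_ring
  have h3 : 0 ≤ (B.transpose * K * B).trace := by
    have := (hK.posSemidef.conjTranspose_mul_mul_same B).trace_nonneg
    simpa using this
  have h4 : 0 ≤ ((K * B).transpose * (K * B)).trace := by
    rw [← hsum]
    positivity
  rw [h1, h2, Matrix.trace_add, Matrix.trace_add, Matrix.trace_smul, smul_eq_mul]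
  linarith

theorem exists_polar {n : ℕ} {G : Matrix (Fin n) (Fin n) ℝ} (hG : 0 < G.det) :
    ∃ Q K : Matrix (Fin n) (Fin n) ℝ, Q * Q.transpose = 1 ∧ Q.det = 1 ∧ K.PosDef ∧
      G = Q * K ∧ K * K = G.transpose * G := by
  have hu : IsUnit G := by
    rw [Matrix.isUnit_iff_isUnit_det]
    exact isUnit_iff_ne_zero.2 hG.ne'
  have hP : (G.transpose * G).PosDef := by
    have := Matrix.PosDef.conjTranspose_mul_self G (Matrix.mulVec_injective_of_isUnit hu)
    simpa using this
  obtain ⟨K, hK, hKK⟩ := exists_posDef_sqrt hP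
  have hKt : K.transpose = K := by simpa using hK.isHermitian.eq
  have hdet : IsUnit K.det := isUnit_iff_ne_zero.2 hK.det_pos.ne'
  have hQ : (G * K⁻¹).transpose * (G * K⁻¹) = 1 := by
    rw [Matrix.transpose_mul, Matrix.transpose_nonsing_inv, hKt]
    calc K⁻¹ * G.transpose * (G * K⁻¹) = K⁻¹ * (G.transpose * G) * K⁻¹ := by noncomm_ring
      _ = (K⁻¹ * K) * (K * K⁻¹) := by rw [← hKK]; noncomm_ring
      _ = 1 := by rw [Matrix.nonsing_inv_mul _ hdet, Matrix.mul_nonsing_inv _ hdet, one_mul]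
  refine ⟨G * K⁻¹, K, mul_eq_one_comm.1 hQ, ?_, hK, ?_, hKK⟩
  · have h1 : (G * K⁻¹).det ^ 2 = 1 := by
      have := congrArg Matrix.det hQ
      rwa [Matrix.det_mul, Matrix.det_transpose, Matrix.det_one, ← sq] at this
    have h2 : 0 < (G * K⁻¹).det := by
      rw [Matrix.det_mul, Matrix.det_nonsing_inv, Ring.inverse_eq_inv']
      exact mul_pos hG (inv_pos.2 hK.det_pos)
    nlinarith
  · rw [Matrix.mul_assoc, Matrix.nonsing_inv_mul _ hdet, Matrix.mul_one]

theorem exists_quadratic_bound {E : Type*} [NormedAddCommGroup E] [NormedSpace ℝ E]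
    {f : E → ℝ} {x₀ : E} (hf : ContDiffAt ℝ 2 f x₀) (h0 : f x₀ = 0) (hnn : ∀ x, 0 ≤ f x) :
    ∃ C r : ℝ, 0 ≤ C ∧ 0 < r ∧ ∀ x, ‖x - x₀‖ < r → f x ≤ C * ‖x - x₀‖ ^ 2 := by
  have hf1 : ContDiffAt ℝ 1 (fderiv ℝ f) x₀ := hf.fderiv_right (by norm_num)
  obtain ⟨K, t, ht, hK⟩ := hf1.exists_lipschitzOnWith
  have hmin : fderiv ℝ f x₀ = 0 :=
    IsLocalMin.fderiv_eq_zero (Filter.Eventually.of_forall fun x => h0 ▸ hnn x)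
  have hdiff : ∀ᶠ x in nhds x₀, DifferentiableAt ℝ f x := by
    filter_upwards [hf.eventually (by simp)] with x hx
    exact hx.differentiableAt (by norm_num)
  obtain ⟨r, hr, hrt⟩ := Metric.mem_nhds_iff.1 (Filter.inter_mem ht hdiff)
  refine ⟨K, r, K.2, hr, fun x hx => ?_⟩
  have hsub : Metric.closedBall x₀ ‖x - x₀‖ ⊆ Metric.ball x₀ r :=
    Metric.closedBall_subset_ball hx
  have hbound : ∀ y ∈ Metric.closedBall x₀ ‖x - x₀‖, ‖fderiv ℝ f y‖ ≤ K * ‖x - x₀‖ := by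
    intro y hy
    have h1 := hK.dist_le_mul y (hrt (hsub hy)).1 x₀ (mem_of_mem_nhds ht)
    rw [hmin, dist_zero_right] at h1
    exact h1.trans (mul_le_mul_of_nonneg_left hy K.2)
  have := (convex_closedBall x₀ ‖x - x₀‖).norm_image_sub_le_of_norm_fderiv_le
    (fun y hy => (hrt (hsub hy)).2) hbound
    (Metric.mem_closedBall_self (norm_nonneg _)) (y := x) (by simp [dist_eq_norm])
  rw [h0, sub_zero] at this
  calc f x ≤ ‖f x‖ := le_abs_self _
    _ ≤ _ := this
    _ = _ := by ring

theorem exists_density_bound {n : ℕ} {W : (Fin n → Fin n → ℝ) → ℝ≥0∞}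
    (hW0 : W matId = 0)
    (hWframe : ∀ R ∈ SOset n, ∀ F, W (matMul R F) = W F)
    (hWreg : ∃ U : Set (Fin n → Fin n → ℝ), IsOpen U ∧ SOset n ⊆ U ∧
        (∀ F ∈ U, W F ≠ ⊤) ∧ ContDiffOn ℝ 2 (fun F => (W F).toReal) U) :
    ∃ C η : ℝ, 0 ≤ C ∧ 0 < η ∧ ∀ G : Fin n → Fin n → ℝ, 0 < (Matrix.of G).det →
      ∀ δ : ℝ, δ < η → (∀ i j, |((Matrix.of G).transpose * Matrix.of G - 1) i j| ≤ δ) →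
        W G ≤ ENNReal.ofReal (C * δ ^ 2) := by
  obtain ⟨U, hUo, hSU, hfin, hreg⟩ := hWreg
  have hId : (matId : Fin n → Fin n → ℝ) ∈ U := by
    refine hSU ⟨?_, ?_⟩
    · apply Matrix.of.injective
      rw [matMul_eq_mul]
      have : (Matrix.of fun i j => (matId : Fin n → Fin n → ℝ) j i) = 1 := by
        ext i j
        simp [matId, Matrix.one_apply, eq_comm]
      rw [this, matId_eq_one, one_mul]
    · rw [matId_eq_one, Matrix.det_one]
  obtain ⟨C, r, hC, hr, hq⟩ := exists_quadratic_bound (hreg.contDiffAt (hUo.mem_nhds hId))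
    (by rw [hW0]; rfl) (fun _ => ENNReal.toReal_nonneg)
  obtain ⟨r', hr', hrU⟩ := Metric.isOpen_iff.1 hUo _ hId
  refine ⟨C * (n : ℝ) ^ 2, min r r' / (n + 1), by positivity, by positivity,
    fun G hG δ hδ hGδ => ?_⟩
  obtain ⟨Q, K, hQ, hQd, hK, hGQ, hKK⟩ := exists_polar hG
  obtain ⟨Q, rfl⟩ := Matrix.of.surjective Q
  obtain ⟨K, rfl⟩ := Matrix.of.surjective K
  have hWG : W G = W K := by
    have h := hWframe Q ⟨by
      apply Matrix.of.injective
      rw [matMul_eq_mul, matId_eq_one]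
      exact hQ, hQd⟩ K
    rw [← h]
    apply congrArg W
    apply Matrix.of.injective
    rw [hGQ, matMul_eq_mul]
  by_cases hn : n = 0
  · subst hn
    have : G = (matId : Fin 0 → Fin 0 → ℝ) := Subsingleton.elim _ _
    rw [this, hW0]
    exact zero_le
  have hn' : (1 : ℝ) ≤ n := by exact_mod_cast Nat.one_le_iff_ne_zero.2 hn
  have hδ0 : 0 ≤ δ := (abs_nonneg _).trans
    (hGδ ⟨0, Nat.pos_of_ne_zero hn⟩ ⟨0, Nat.pos_of_ne_zero hn⟩)
  have hentry : ∀ i j, |(Matrix.of K - 1) i j| ≤ n * δ := by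
    intro i j
    apply abs_le_of_sq_le_sq _ (by positivity)
    calc (Matrix.of K - 1) i j ^ 2 ≤ ∑ j, (Matrix.of K - 1) i j ^ 2 :=
          Finset.single_le_sum (f := fun j => (Matrix.of K - 1) i j ^ 2)
            (fun _ _ => sq_nonneg _) (Finset.mem_univ j)
      _ ≤ ∑ i, ∑ j, (Matrix.of K - 1) i j ^ 2 :=
          Finset.single_le_sum (f := fun i => ∑ j, (Matrix.of K - 1) i j ^ 2)
            (fun _ _ => Finset.sum_nonneg fun _ _ => sq_nonneg _) (Finset.mem_univ i)
      _ ≤ ∑ i, ∑ j, (Matrix.of K * Matrix.of K - 1) i j ^ 2 := sum_sq_sub_one_le hK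
      _ ≤ ∑ _i : Fin n, ∑ _j : Fin n, δ ^ 2 := by
          refine Finset.sum_le_sum fun i _ => Finset.sum_le_sum fun j _ => ?_
          rw [hKK]
          exact sq_le_sq' (neg_le_of_abs_le (hGδ i j)) (le_of_abs_le (hGδ i j))
      _ = (n * δ) ^ 2 := by simp; ring
  have hnorm : ‖K - matId‖ ≤ n * δ := by
    refine (pi_norm_le_iff_of_nonneg (by positivity)).2 fun i =>
      (pi_norm_le_iff_of_nonneg (by positivity)).2 fun j => ?_
    have := hentry i j
    rwa [← matId_eq_one] at this
  have hlt : n * δ < min r r' := by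
    rw [lt_div_iff₀ (by positivity)] at hδ
    nlinarith
  have h1 := hq K (hnorm.trans_lt (hlt.trans_le (min_le_left _ _)))
  have h2 : W K ≠ ⊤ := hfin K (hrU (by
    rw [Metric.mem_ball, dist_eq_norm]
    exact hnorm.trans_lt (hlt.trans_le (min_le_right _ _))))
  rw [hWG, ← ENNReal.ofReal_toReal h2]
  apply ENNReal.ofReal_le_ofReal
  calc _ ≤ C * ‖K - matId‖ ^ 2 := h1
    _ ≤ C * (n * δ) ^ 2 := by gcongr
    _ = _ := by ring

theorem isOpen_thinFilm {d k : ℕ} {ω : Set (Fin d → ℝ)} (hω : IsOpen ω) (h : ℝ) :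
    IsOpen (thinFilm ω h (k := k)) := by
  have h1 : Continuous (xpart : (Fin (d + k) → ℝ) → Fin d → ℝ) := by
    unfold xpart
    fun_prop
  have h2 : Continuous fun p : Fin (d + k) → ℝ => ∑ j, zpart p j ^ 2 := by
    unfold zpart
    fun_prop
  exact (hω.preimage h1).inter (isOpen_lt h2 continuous_const)

theorem energy_le_of_forall_le {d k : ℕ} {ω : Set (Fin d → ℝ)} (hω : IsOpen ω) (h : ℝ)
    {W : (Fin (d + k) → Fin (d + k) → ℝ) → ℝ≥0∞} {u : (Fin (d + k) → ℝ) → Fin (d + k) → ℝ}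
    {R : (Fin d → ℝ) → Fin (d + k) → Fin (d + k) → ℝ} {c : ℝ≥0∞}
    (hc : ∀ p ∈ thinFilm ω h (k := k), W (matMul (matJac u p) (R (xpart p))) ≤ c) :
    energy ω h W u R ≤ c := by
  unfold energy
  calc _ ≤ (volume (thinFilm ω h (k := k)))⁻¹ * ∫⁻ _ in thinFilm ω h (k := k), c := by
        gcongr 1
        exact setLIntegral_mono' (isOpen_thinFilm hω h).measurableSet hc
    _ = ((volume (thinFilm ω h (k := k)))⁻¹ * volume (thinFilm ω h (k := k))) * c := by
        rw [setLIntegral_const]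
        ring
    _ ≤ 1 * c := by
        gcongr
        exact ENNReal.inv_mul_le_one _
    _ = c := one_mul c

theorem half_sum_sq_le_quadraticForm {n : ℕ} {g : Fin n → Fin n → ℝ}
    (hg : ∀ i j, n * |g i j - matId i j| ≤ 1 / 2) (ξ : Fin n → ℝ) :
    1 / 2 * ∑ i, ξ i ^ 2 ≤ ∑ i, ∑ j, g i j * ξ i * ξ j := by
  have h1 : ∀ i j, matId i j * ξ i * ξ j - (1 / (2 * n)) * (ξ i ^ 2 / 2 + ξ j ^ 2 / 2)
      ≤ g i j * ξ i * ξ j := by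
    intro i j
    have hn : (0 : ℝ) < n := by exact_mod_cast i.pos
    have h2 : |g i j - matId i j| ≤ 1 / (2 * n) := by
      rw [le_div_iff₀ (by positivity)]
      linarith [hg i j]
    have h3 : |(g i j - matId i j) * (ξ i * ξ j)| ≤ 1 / (2 * n) * (ξ i ^ 2 / 2 + ξ j ^ 2 / 2) := by
      rw [abs_mul]
      gcongr
      rw [abs_le]
      constructor <;> nlinarith [sq_nonneg (ξ i + ξ j), sq_nonneg (ξ i - ξ j)]
    linarith [neg_le_of_abs_le h3]
  refine le_trans (le_of_eq ?_)
    (Finset.sum_le_sum fun i _ => Finset.sum_le_sum fun j _ => h1 i j)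
  rcases Nat.eq_zero_or_pos n with rfl | hn
  · simp
  have hn' : (n : ℝ) ≠ 0 := by positivity
  simp only [Finset.sum_sub_distrib, ← Finset.mul_sum, Finset.sum_add_distrib, Finset.sum_const,
    Finset.card_univ, Fintype.card_fin, nsmul_eq_mul, ← Finset.sum_div]
  simp only [matId, ite_mul, one_mul, zero_mul, Finset.sum_ite_eq, Finset.mem_univ, if_true, ← sq]
  field_simp
  ring

theorem exists_inv_sqrt {n : ℕ} {g : Fin n → Fin n → ℝ} (hsym : ∀ i j, g i j = g j i)
    (hg : ∀ i j, n * |g i j - matId i j| ≤ 1 / 2) :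
    ∃ R, PosDefFun R ∧ matMul (matMul R R) g = matId := by
  have hpd : PosDefFun g := by
    refine ⟨hsym, fun ξ hξ => lt_of_lt_of_le ?_ (half_sum_sq_le_quadraticForm hg ξ)⟩
    obtain ⟨i, hi⟩ := Function.ne_iff.1 hξ
    have : 0 < ξ i ^ 2 := by
      have : ξ i ≠ 0 := hi
      positivity
    have h2 := Finset.single_le_sum (f := fun i => ξ i ^ 2) (fun _ _ => sq_nonneg _)
      (Finset.mem_univ i)
    linarith
  rw [posDefFun_iff] at hpd
  obtain ⟨K, hK, hKK⟩ := exists_posDef_sqrt hpd.inv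
  obtain ⟨K, rfl⟩ := Matrix.of.surjective K
  refine ⟨K, (posDefFun_iff K).2 hK, Matrix.of.injective ?_⟩
  rw [matMul_eq_mul, matMul_eq_mul, hKK, matId_eq_one]
  exact Matrix.nonsing_inv_mul _ (isUnit_iff_ne_zero.2 hpd.det_pos.ne')

theorem conj_eq_one_of_inv_sqrt {n : ℕ} {R g : Fin n → Fin n → ℝ}
    (hRg : matMul (matMul R R) g = matId) :
    Matrix.of R * Matrix.of g * Matrix.of R = 1 := by
  have h := congrArg Matrix.of hRg
  rw [matMul_eq_mul, matMul_eq_mul, matId_eq_one, Matrix.mul_assoc] at h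
  exact mul_eq_one_comm.1 h

theorem abs_inv_sqrt_le {n : ℕ} {R g : Fin n → Fin n → ℝ}
    (hg : ∀ i j, n * |g i j - matId i j| ≤ 1 / 2) (hR : PosDefFun R)
    (hRg : matMul (matMul R R) g = matId) (i j : Fin n) : |R i j| ≤ 2 := by
  have h1 : ∑ a, ∑ b, g a b * R a j * R b j = 1 := by
    have h := congrFun (congrFun (conj_eq_one_of_inv_sqrt hRg) j) j
    simp only [Matrix.mul_apply, Matrix.of_apply, Matrix.one_apply_eq, Finset.sum_mul] at h
    rw [← h, Finset.sum_comm]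
    refine Finset.sum_congr rfl fun b _ => Finset.sum_congr rfl fun a _ => ?_
    rw [hR.1 j a]
    ring
  have h2 := half_sum_sq_le_quadraticForm hg fun a => R a j
  have h3 := Finset.single_le_sum (f := fun a => R a j ^ 2) (fun _ _ => sq_nonneg _)
      (Finset.mem_univ i)
  apply abs_le_of_sq_le_sq _ (by norm_num)
  linarith

theorem abs_gram_sub_one_le {n : ℕ} {R g F : Fin n → Fin n → ℝ} {τ : ℝ}
    (hg : ∀ i j, n * |g i j - matId i j| ≤ 1 / 2) (hR : PosDefFun R)
    (hRg : matMul (matMul R R) g = matId)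
    (hF : ∀ i j, |∑ l, F l i * F l j - g i j| ≤ τ) (i j : Fin n) :
    |((Matrix.of (matMul F R)).transpose * Matrix.of (matMul F R) - 1) i j|
      ≤ 4 * (n : ℝ) ^ 2 * τ := by
  have hRt : (Matrix.of R).transpose = Matrix.of R := by
    ext a b
    exact hR.1 b a
  have hE : (Matrix.of (matMul F R)).transpose * Matrix.of (matMul F R) - 1
      = Matrix.of R * ((Matrix.of F).transpose * Matrix.of F - Matrix.of g) * Matrix.of R := by
    rw [matMul_eq_mul, Matrix.transpose_mul, hRt, Matrix.mul_sub, Matrix.sub_mul,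
      conj_eq_one_of_inv_sqrt hRg]
    noncomm_ring
  have hEab : ∀ a b, |((Matrix.of F).transpose * Matrix.of F - Matrix.of g) a b| ≤ τ := by
    intro a b
    simpa [Matrix.mul_apply] using hF a b
  rw [hE, Matrix.mul_apply]
  simp only [Matrix.mul_apply (M := Matrix.of R), Finset.sum_mul]
  calc _ ≤ ∑ _b : Fin n, ∑ _a : Fin n, 2 * τ * 2 := by
        refine (Finset.abs_sum_le_sum_abs _ _).trans (Finset.sum_le_sum fun b _ =>
          (Finset.abs_sum_le_sum_abs _ _).trans (Finset.sum_le_sum fun a _ => ?_))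
        rw [abs_mul, abs_mul]
        have hτ := (abs_nonneg _).trans (hEab a b)
        gcongr
        · exact abs_inv_sqrt_le hg hR hRg i a
        · exact hEab a b
        · exact abs_inv_sqrt_le hg hR hRg b j
    _ = _ := by
        simp
        ring

theorem exists_det_pos_nhds_one (n : ℕ) : ∃ η : ℝ, 0 < η ∧ ∀ F : Fin n → Fin n → ℝ,
    (∀ i j, |F i j - matId i j| < η) → 0 < (Matrix.of F).det := by
  have hc : Continuous fun F : Fin n → Fin n → ℝ => (Matrix.of F).det :=
    Continuous.matrix_det (A := fun F : Fin n → Fin n → ℝ => Matrix.of F) continuous_id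
  have hopen : IsOpen {F : Fin n → Fin n → ℝ | 0 < (Matrix.of F).det} :=
    isOpen_lt continuous_const hc
  have hmem : matId ∈ {F : Fin n → Fin n → ℝ | 0 < (Matrix.of F).det} := by
    simp [matId_eq_one]
  obtain ⟨η, hη, hsub⟩ := Metric.isOpen_iff.1 hopen _ hmem
  refine ⟨η, hη, fun F hF => hsub ?_⟩
  rw [Metric.mem_ball, dist_eq_norm]
  exact (pi_norm_lt_iff hη).2 fun i => (pi_norm_lt_iff hη).2 fun j => hF i j

theorem exists_mul_rpow_lt (A : ℝ) {e η : ℝ} (he : 0 < e) (hη : 0 < η) :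
    ∃ h₀ : ℝ, 0 < h₀ ∧ ∀ h, 0 < h → h < h₀ → A * h ^ e < η := by
  have ht : Filter.Tendsto (fun h : ℝ => A * h ^ e) (nhds 0) (nhds 0) := by
    have := ((Real.continuousAt_rpow_const 0 e (Or.inr he.le)).tendsto).const_mul A
    simpa [Real.zero_rpow he.ne'] using this
  obtain ⟨h₀, hh₀, hlt⟩ := Metric.eventually_nhds_iff.1 (ht.eventually_lt_const hη)
  refine ⟨h₀, hh₀, fun h hh hlt' => hlt ?_⟩
  rw [dist_zero_right, Real.norm_of_nonneg hh.le]
  exact hlt'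

theorem exists_energy_bound_of_metric_bound {d k : ℕ} {ω : Set (Fin d → ℝ)} (hω : IsOpen ω)
    (hωbd : Bornology.IsBounded ω)
    {S : (Fin d → ℝ) → Fin (d + k) → Fin (d + k) → ℝ}
    (hS : Continuous S) (hSsym : ∀ x i j, S x i j = S x j i)
    {γ : ℝ} (hγ : 0 < γ) {W : (Fin (d + k) → Fin (d + k) → ℝ) → ℝ≥0∞}
    (hW0 : W matId = 0)
    (hWframe : ∀ R ∈ SOset (d + k), ∀ F, W (matMul R F) = W F)
    (hWreg : ∃ U : Set (Fin (d + k) → Fin (d + k) → ℝ), IsOpen U ∧ SOset (d + k) ⊆ U ∧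
        (∀ F ∈ U, W F ≠ ⊤) ∧ ContDiffOn ℝ 2 (fun F => (W F).toReal) U)
    {A e e' b h₁ : ℝ} (he : 0 < e) (he' : 0 < e') (hb : b ≤ 2 * e) (hh₁ : 0 < h₁)
    (hu : ∀ h, 0 < h → h < h₁ → ∃ u : (Fin (d + k) → ℝ) → Fin (d + k) → ℝ,
      ContDiff ℝ (⊤ : ℕ∞) u ∧ ∀ p ∈ thinFilm ω h (k := k),
        (∀ i j, |matJac u p i j - matId i j| ≤ A * h ^ e') ∧
        ∀ i j, |∑ l, matJac u p l i * matJac u p l j - prestrain S γ h (xpart p) i j|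
          ≤ A * h ^ e) :
    ∃ C : ℝ, 0 < C ∧ ∃ h₀ : ℝ, 0 < h₀ ∧ ∀ h : ℝ, 0 < h → h < h₀ →
        (∃ R, IsInvSqrt ω S γ h R) ∧
        ∃ u : (Fin (d + k) → ℝ) → Fin (d + k) → ℝ, ContDiff ℝ (⊤ : ℕ∞) u ∧
          ∀ R, IsInvSqrt ω S γ h R →
            energy ω h W u R ≤ ENNReal.ofReal (C * h ^ b) := by
  obtain ⟨C, η, hC, hη, hdens⟩ := exists_density_bound hW0 hWframe hWreg
  obtain ⟨ηd, hηd, hdet⟩ := exists_det_pos_nhds_one (d + k)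
  obtain ⟨B, hB⟩ := hωbd.isCompact_closure.exists_bound_of_continuousOn hS.continuousOn
  have hSB : ∀ x ∈ closure ω, ∀ i j, |S x i j| ≤ B := fun x hx i j =>
    (norm_le_pi_norm (S x i) j).trans ((norm_le_pi_norm (S x) i).trans (hB x hx))
  obtain ⟨h₂, hh₂, hlt₂⟩ := exists_mul_rpow_lt (4 * ((d + k : ℕ) : ℝ) ^ 2 * A) he hη
  obtain ⟨h₃, hh₃, hlt₃⟩ := exists_mul_rpow_lt A he' hηd
  obtain ⟨h₄, hh₄, hlt₄⟩ := exists_mul_rpow_lt (((d + k : ℕ) : ℝ) * (2 * B)) (half_pos hγ)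
    (half_pos one_pos)
  have hclose : ∀ h, 0 < h → h < h₄ → ∀ x ∈ closure ω, ∀ i j,
      ((d + k : ℕ) : ℝ) * |prestrain S γ h x i j - matId i j| ≤ 1 / 2 := by
    intro h hh hlt x hx i j
    have h1 : prestrain S γ h x i j - matId i j = 2 * h ^ (γ / 2) * S x i j := by
      simp [prestrain]
    rw [h1, abs_mul, abs_of_nonneg (by positivity)]
    calc _ ≤ ((d + k : ℕ) : ℝ) * (2 * h ^ (γ / 2) * B) := by
          gcongr
          exact hSB x hx i j
      _ = ((d + k : ℕ) : ℝ) * (2 * B) * h ^ (γ / 2) := by ring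
      _ ≤ _ := (hlt₄ h hh hlt).le
  refine ⟨C * (4 * ((d + k : ℕ) : ℝ) ^ 2 * A) ^ 2 + 1, by positivity,
    min 1 (min h₁ (min h₂ (min h₃ h₄))), by positivity, fun h hh hlt => ?_⟩
  simp only [lt_min_iff] at hlt
  obtain ⟨hl, hl₁, hl₂, hl₃, hl₄⟩ := hlt
  refine ⟨?_, ?_⟩
  · have hex : ∀ x, ∃ R, x ∈ closure ω →
        PosDefFun R ∧ matMul (matMul R R) (prestrain S γ h x) = matId := by
      intro x
      by_cases hx : x ∈ closure ω
      · obtain ⟨R, hR⟩ := exists_inv_sqrt (g := prestrain S γ h x) (fun i j => by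
          simp [prestrain, hSsym x i j, matId, eq_comm]) (hclose h hh hl₄ x hx)
        exact ⟨R, fun _ => hR⟩
      · exact ⟨0, fun h => absurd h hx⟩
    choose R hR using hex
    exact ⟨R, hR⟩
  · obtain ⟨u, hus, hub⟩ := hu h hh hl₁
    refine ⟨u, hus, fun R hR => energy_le_of_forall_le hω h fun p hp => ?_⟩
    have hx : xpart p ∈ closure ω := subset_closure hp.1
    obtain ⟨hRp, hRg⟩ := hR _ hx
    obtain ⟨hp1, hp2⟩ := hub p hp
    have hdetpos : 0 < (Matrix.of (matMul (matJac u p) (R (xpart p)))).det := by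
      rw [matMul_eq_mul, Matrix.det_mul]
      exact mul_pos (hdet _ fun i j => (hp1 i j).trans_lt (hlt₃ h hh hl₃))
        ((posDefFun_iff _).1 hRp).det_pos
    refine (hdens _ hdetpos (4 * ((d + k : ℕ) : ℝ) ^ 2 * A * h ^ e) (hlt₂ h hh hl₂) fun i j => ?_).trans
      (ENNReal.ofReal_le_ofReal ?_)
    · rw [mul_assoc]
      exact abs_gram_sub_one_le (hclose h hh hl₄ _ hx) hRp hRg hp2 i j
    · have h1 : (h ^ e) ^ 2 = h ^ (2 * e) := by
        rw [← Real.rpow_natCast, ← Real.rpow_mul hh.le]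
        ring_nf
      have h2 : h ^ (2 * e) ≤ h ^ b := Real.rpow_le_rpow_of_exponent_ge hh hl.le hb
      have h3 : 0 < h ^ b := Real.rpow_pos_of_pos hh b
      calc _ = C * (4 * ((d + k : ℕ) : ℝ) ^ 2 * A) ^ 2 * h ^ (2 * e) := by rw [← h1]; ring
        _ ≤ C * (4 * ((d + k : ℕ) : ℝ) ^ 2 * A) ^ 2 * h ^ b := by gcongr
        _ ≤ _ := by linarith

section PartialDerivative

variable {d : ℕ} {f g : (Fin d → ℝ) → ℝ} {x : Fin d → ℝ}

theorem pd_add (hf : DifferentiableAt ℝ f x) (hg : DifferentiableAt ℝ g x) (i : Fin d) :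
    pd i (fun y => f y + g y) x = pd i f x + pd i g x := by
  simp [pd, fderiv_fun_add hf hg]

theorem pd_sub (hf : DifferentiableAt ℝ f x) (hg : DifferentiableAt ℝ g x) (i : Fin d) :
    pd i (fun y => f y - g y) x = pd i f x - pd i g x := by
  simp [pd, fderiv_fun_sub hf hg]

theorem pd_mul (hf : DifferentiableAt ℝ f x) (hg : DifferentiableAt ℝ g x) (i : Fin d) :
    pd i (fun y => f y * g y) x = pd i f x * g x + f x * pd i g x := by
  simp [pd, fderiv_fun_mul hf hg]
  ring

theorem pd_const (c : ℝ) (i : Fin d) : pd i (fun _ : Fin d → ℝ => c) x = 0 := by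
  simp [pd]

theorem pd_const_mul (c : ℝ) (hf : DifferentiableAt ℝ f x) (i : Fin d) :
    pd i (fun y => c * f y) x = c * pd i f x := by
  rw [pd_mul (differentiableAt_const c) hf, pd_const, zero_mul, zero_add]

theorem pd_sum {α : Type*} (s : Finset α) {F : α → (Fin d → ℝ) → ℝ}
    (hF : ∀ a ∈ s, DifferentiableAt ℝ (F a) x) (i : Fin d) :
    pd i (fun y => ∑ a ∈ s, F a y) x = ∑ a ∈ s, pd i (F a) x := by
  simp [pd, fderiv_fun_sum hF]

theorem pd_coord (j i : Fin d) : pd i (fun y : Fin d → ℝ => y j) x = if j = i then 1 else 0 := by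
  have : HasFDerivAt (fun y : Fin d → ℝ => y j)
      (ContinuousLinearMap.proj (R := ℝ) (φ := fun _ : Fin d => ℝ) j) x := hasFDerivAt_apply j x
  simp [pd, this.fderiv, Pi.single_apply]

theorem pd_linear (η : Fin d → ℝ) (i : Fin d) : pd i (fun y => ∑ a, η a * y a) x = η i := by
  rw [pd_sum _ (fun a _ => by fun_prop)]
  have : ∀ a, pd i (fun y : Fin d → ℝ => η a * y a) x = η a * if a = i then 1 else 0 := by
    intro a
    rw [pd_const_mul _ (by fun_prop), pd_coord]
  simp [this]

theorem pd_sin (hf : DifferentiableAt ℝ f x) (i : Fin d) :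
    pd i (fun y => sin (f y)) x = cos (f x) * pd i f x := by
  simp [pd, fderiv_sin hf]

theorem pd_cos (hf : DifferentiableAt ℝ f x) (i : Fin d) :
    pd i (fun y => cos (f y)) x = -sin (f x) * pd i f x := by
  simp [pd, fderiv_cos hf]

theorem pd_rpow_const (hf : DifferentiableAt ℝ f x) (hx : f x ≠ 0) (p : ℝ) (i : Fin d) :
    pd i (fun y => f y ^ p) x = p * f x ^ (p - 1) * pd i f x := by
  have := (hf.hasFDerivAt.rpow_const (p := p) (Or.inl hx)).fderiv
  simp [pd, this]

theorem contDiff_pd {E : Type*} [NormedAddCommGroup E] [NormedSpace ℝ E]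
    {f : (Fin d → ℝ) → E} (hf : ContDiff ℝ (⊤ : ℕ∞) f) (i : Fin d) :
    ContDiff ℝ (⊤ : ℕ∞) (pd i f) :=
  (hf.fderiv_right (m := (⊤ : ℕ∞)) (by simp)).clm_apply contDiff_const

end PartialDerivative

theorem ContDiff.diffAt {d : ℕ} {f : (Fin d → ℝ) → ℝ} (hf : ContDiff ℝ (⊤ : ℕ∞) f)
    (x : Fin d → ℝ) : DifferentiableAt ℝ f x :=
  (hf.differentiable (by simp)).differentiableAt

/-- All partial derivatives up to order `n` of the family `f` grow, uniformly in space, at most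
like `σ ^ (m + ℓ * order)`. -/
def SymbolBound {d : ℕ} {ι : Type*} (σ : ι → ℝ) (ℓ : ℝ) :
    ℕ → ℝ → (ι → (Fin d → ℝ) → ℝ) → Prop
  | 0, m, f => ∃ C, 0 ≤ C ∧ ∀ i x, |f i x| ≤ C * σ i ^ m
  | n + 1, m, f => (∃ C, 0 ≤ C ∧ ∀ i x, |f i x| ≤ C * σ i ^ m) ∧
      ∀ a, SymbolBound σ ℓ n (m + ℓ) (fun i => pd a (f i))

/-- A family of smooth functions of size `σ ^ m`, each derivative of which costs `σ ^ ℓ`. -/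
structure IsSymbol {d : ℕ} {ι : Type*} (σ : ι → ℝ) (ℓ m : ℝ) (f : ι → (Fin d → ℝ) → ℝ) :
    Prop where
  smooth : ∀ i, ContDiff ℝ (⊤ : ℕ∞) (f i)
  bound : ∀ n, SymbolBound σ ℓ n m f

section Symbol

variable {d : ℕ} {ι : Type*} {σ : ι → ℝ} {ℓ ℓ' m m' : ℝ} {f g : ι → (Fin d → ℝ) → ℝ}

theorem SymbolBound.exists_bound {n : ℕ} (hf : SymbolBound σ ℓ n m f) :
    ∃ C, 0 ≤ C ∧ ∀ i x, |f i x| ≤ C * σ i ^ m := by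
  cases n with
  | zero => exact hf
  | succ n => exact hf.1

theorem SymbolBound.of_succ {n : ℕ} (hf : SymbolBound σ ℓ (n + 1) m f) :
    SymbolBound σ ℓ n m f := by
  induction n generalizing m f with
  | zero => exact hf.1
  | succ n ih => exact ⟨hf.1, fun a => ih (hf.2 a)⟩

theorem SymbolBound.mono (hσ : ∀ i, 1 ≤ σ i) (hm : m ≤ m') (hℓ : ℓ ≤ ℓ') {n : ℕ}
    (hf : SymbolBound σ ℓ n m f) : SymbolBound σ ℓ' n m' f := by
  have key : ∀ {m m' : ℝ} {f : ι → (Fin d → ℝ) → ℝ}, m ≤ m' →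
      (∃ C, 0 ≤ C ∧ ∀ i x, |f i x| ≤ C * σ i ^ m) →
      ∃ C, 0 ≤ C ∧ ∀ i x, |f i x| ≤ C * σ i ^ m' := by
    rintro m m' f hm ⟨C, hC, h⟩
    refine ⟨C, hC, fun i x => (h i x).trans ?_⟩
    gcongr
    exact hσ i
  induction n generalizing m m' f with
  | zero => exact key hm hf
  | succ n ih => exact ⟨key hm hf.1, fun a => ih (by linarith) (hf.2 a)⟩

theorem SymbolBound.add {n : ℕ} (hfs : ∀ i, ContDiff ℝ (⊤ : ℕ∞) (f i))
    (hgs : ∀ i, ContDiff ℝ (⊤ : ℕ∞) (g i))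
    (hf : SymbolBound σ ℓ n m f) (hg : SymbolBound σ ℓ n m g) :
    SymbolBound σ ℓ n m (fun i x => f i x + g i x) := by
  have key : ∀ {m : ℝ} {f g : ι → (Fin d → ℝ) → ℝ},
      (∃ C, 0 ≤ C ∧ ∀ i x, |f i x| ≤ C * σ i ^ m) →
      (∃ C, 0 ≤ C ∧ ∀ i x, |g i x| ≤ C * σ i ^ m) →
      ∃ C, 0 ≤ C ∧ ∀ i x, |f i x + g i x| ≤ C * σ i ^ m := by
    rintro m f g ⟨C, hC, h⟩ ⟨C', hC', h'⟩
    refine ⟨C + C', by positivity, fun i x => (abs_add_le _ _).trans ?_⟩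
    linarith [h i x, h' i x]
  induction n generalizing m f g with
  | zero => exact key hf hg
  | succ n ih =>
    refine ⟨key hf.1 hg.1, fun a => ?_⟩
    have : (fun i => pd a (fun x => f i x + g i x))
        = fun i x => pd a (f i) x + pd a (g i) x := by
      funext i x
      exact pd_add ((hfs i).diffAt x) ((hgs i).diffAt x) a
    rw [this]
    exact ih (fun i => contDiff_pd (hfs i) a) (fun i => contDiff_pd (hgs i) a) (hf.2 a) (hg.2 a)

theorem SymbolBound.mul (hσ : ∀ i, 1 ≤ σ i) {n : ℕ} (hfs : ∀ i, ContDiff ℝ (⊤ : ℕ∞) (f i))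
    (hgs : ∀ i, ContDiff ℝ (⊤ : ℕ∞) (g i))
    (hf : SymbolBound σ ℓ n m f) (hg : SymbolBound σ ℓ n m' g) :
    SymbolBound σ ℓ n (m + m') (fun i x => f i x * g i x) := by
  have key : ∀ {m m' : ℝ} {f g : ι → (Fin d → ℝ) → ℝ},
      (∃ C, 0 ≤ C ∧ ∀ i x, |f i x| ≤ C * σ i ^ m) →
      (∃ C, 0 ≤ C ∧ ∀ i x, |g i x| ≤ C * σ i ^ m') →
      ∃ C, 0 ≤ C ∧ ∀ i x, |f i x * g i x| ≤ C * σ i ^ (m + m') := by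
    rintro m m' f g ⟨C, hC, h⟩ ⟨C', hC', h'⟩
    refine ⟨C * C', by positivity, fun i x => ?_⟩
    have hs : 0 < σ i := one_pos.trans_le (hσ i)
    rw [abs_mul, Real.rpow_add hs]
    calc _ ≤ (C * σ i ^ m) * (C' * σ i ^ m') :=
          mul_le_mul (h i x) (h' i x) (abs_nonneg _) (by positivity)
      _ = _ := by ring
  induction n generalizing m m' f g with
  | zero => exact key hf hg
  | succ n ih =>
    refine ⟨key hf.1 hg.1, fun a => ?_⟩
    have : (fun i => pd a (fun x => f i x * g i x))
        = fun i x => pd a (f i) x * g i x + f i x * pd a (g i) x := by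
      funext i x
      exact pd_mul ((hfs i).diffAt x) ((hgs i).diffAt x) a
    rw [this]
    have h1 := ih (fun i => contDiff_pd (hfs i) a) hgs (hf.2 a) hg.of_succ
    have h2 := ih hfs (fun i => contDiff_pd (hgs i) a) hf.of_succ (hg.2 a)
    rw [show m + ℓ + m' = m + m' + ℓ by ring] at h1
    rw [← add_assoc] at h2
    exact h1.add (fun i => (contDiff_pd (hfs i) a).mul (hgs i))
      (fun i => (hfs i).mul (contDiff_pd (hgs i) a)) h2

theorem symbolBound_weight (hσ : ∀ i, 1 ≤ σ i) (ℓ m c : ℝ) (n : ℕ) :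
    SymbolBound (d := d) σ ℓ n m (fun i _ => c * σ i ^ m) := by
  have key : ∀ m c : ℝ, ∃ C, 0 ≤ C ∧ ∀ i, ∀ _ : Fin d → ℝ, |c * σ i ^ m| ≤ C * σ i ^ m := by
    intro m c
    refine ⟨|c|, abs_nonneg c, fun i _ => ?_⟩
    rw [abs_mul, abs_of_nonneg (Real.rpow_nonneg (zero_le_one.trans (hσ i)) m)]
  induction n generalizing m c with
  | zero => exact key m c
  | succ n ih =>
    refine ⟨key m c, fun a => ?_⟩
    have : (fun i => pd a (fun _ : Fin d → ℝ => c * σ i ^ m))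
        = fun i _ => 0 * σ i ^ (m + ℓ) := by
      funext i x
      rw [pd_const, zero_mul]
    rw [this]
    exact ih _ _

namespace IsSymbol

theorem exists_bound (hf : IsSymbol σ ℓ m f) : ∃ C, 0 ≤ C ∧ ∀ i x, |f i x| ≤ C * σ i ^ m :=
  (hf.bound 0).exists_bound

theorem mono (hσ : ∀ i, 1 ≤ σ i) (hf : IsSymbol σ ℓ m f) (hm : m ≤ m') (hℓ : ℓ ≤ ℓ') :
    IsSymbol σ ℓ' m' f :=
  ⟨hf.smooth, fun n => (hf.bound n).mono hσ hm hℓ⟩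

theorem add (hf : IsSymbol σ ℓ m f) (hg : IsSymbol σ ℓ m g) :
    IsSymbol σ ℓ m (fun i x => f i x + g i x) :=
  ⟨fun i => (hf.smooth i).add (hg.smooth i),
    fun n => (hf.bound n).add hf.smooth hg.smooth (hg.bound n)⟩

theorem mul (hσ : ∀ i, 1 ≤ σ i) (hf : IsSymbol σ ℓ m f) (hg : IsSymbol σ ℓ m' g) :
    IsSymbol σ ℓ (m + m') (fun i x => f i x * g i x) :=
  ⟨fun i => (hf.smooth i).mul (hg.smooth i),
    fun n => (hf.bound n).mul hσ hf.smooth hg.smooth (hg.bound n)⟩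

theorem weight (hσ : ∀ i, 1 ≤ σ i) (ℓ m c : ℝ) :
    IsSymbol (d := d) σ ℓ m (fun i _ => c * σ i ^ m) :=
  ⟨fun _ => contDiff_const, fun n => symbolBound_weight hσ ℓ m c n⟩

theorem const (hσ : ∀ i, 1 ≤ σ i) (ℓ c : ℝ) : IsSymbol (d := d) σ ℓ 0 (fun _ _ => c) := by
  simpa using weight (d := d) hσ ℓ 0 c

theorem zero (hσ : ∀ i, 1 ≤ σ i) (ℓ m : ℝ) : IsSymbol (d := d) σ ℓ m (fun _ _ => 0) := by
  simpa using weight (d := d) hσ ℓ m 0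

theorem const_mul (hσ : ∀ i, 1 ≤ σ i) (c : ℝ) (hf : IsSymbol σ ℓ m f) :
    IsSymbol σ ℓ m (fun i x => c * f i x) := by
  simpa using (const (d := d) hσ ℓ c).mul hσ hf

theorem sub (hσ : ∀ i, 1 ≤ σ i) (hf : IsSymbol σ ℓ m f) (hg : IsSymbol σ ℓ m g) :
    IsSymbol σ ℓ m (fun i x => f i x - g i x) := by
  simpa [sub_eq_add_neg] using hf.add (hg.const_mul hσ (-1))

theorem sum (hσ : ∀ i, 1 ≤ σ i) {α : Type*} (s : Finset α) {F : α → ι → (Fin d → ℝ) → ℝ}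
    (hF : ∀ a ∈ s, IsSymbol σ ℓ m (F a)) : IsSymbol σ ℓ m (fun i x => ∑ a ∈ s, F a i x) := by
  classical
  induction s using Finset.induction_on with
  | empty => simpa using zero hσ ℓ m
  | insert a s ha ih =>
    simp only [Finset.sum_insert ha]
    exact (hF a (Finset.mem_insert_self a s)).add
      (ih fun b hb => hF b (Finset.mem_insert_of_mem hb))

theorem pderiv (hf : IsSymbol σ ℓ m f) (a : Fin d) : IsSymbol σ ℓ (m + ℓ) (fun i => pd a (f i)) :=
  ⟨fun i => contDiff_pd (hf.smooth i) a, fun n => (hf.bound (n + 1)).2 a⟩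

theorem rpow_const (hσ : ∀ i, 1 ≤ σ i) (hf : IsSymbol σ ℓ 0 f) (h1 : ∀ i x, 1 ≤ f i x) (p : ℝ) :
    IsSymbol σ ℓ 0 (fun i x => f i x ^ p) := by
  have hne : ∀ i x, f i x ≠ 0 := fun i x => (one_pos.trans_le (h1 i x)).ne'
  have hs : ∀ (p : ℝ) i, ContDiff ℝ (⊤ : ℕ∞) (fun x => f i x ^ p) := fun p i =>
    (hf.smooth i).rpow_const_of_ne (hne i)
  have key : ∀ p : ℝ, ∃ C, 0 ≤ C ∧ ∀ i x, |f i x ^ p| ≤ C * σ i ^ (0 : ℝ) := by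
    intro p
    obtain ⟨C, hC, hb⟩ := hf.exists_bound
    refine ⟨C ^ |p|, by positivity, fun i x => ?_⟩
    have h2 := hb i x
    have h0 := zero_le_one.trans (h1 i x)
    rw [Real.rpow_zero, mul_one] at h2 ⊢
    rw [abs_of_nonneg (Real.rpow_nonneg h0 p)]
    calc f i x ^ p ≤ f i x ^ |p| := Real.rpow_le_rpow_of_exponent_le (h1 i x) (le_abs_self p)
      _ ≤ C ^ |p| := Real.rpow_le_rpow h0 ((le_abs_self _).trans h2) (abs_nonneg p)
  refine ⟨hs p, fun n => ?_⟩
  induction n generalizing p with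
  | zero => exact key p
  | succ n ih =>
    refine ⟨key p, fun a => ?_⟩
    have : (fun i => pd a (fun x => f i x ^ p))
        = fun i x => f i x ^ (p - 1) * (p * pd a (f i) x) := by
      funext i x
      rw [pd_rpow_const ((hf.smooth i).diffAt x) (hne i x)]
      ring
    rw [this]
    have hp := (hf.pderiv a).const_mul hσ p
    have h := (ih (p - 1)).mul hσ (hs (p - 1)) hp.smooth (hp.bound n)
    rwa [zero_add] at h

theorem sin_cos (hσ : ∀ i, 1 ≤ σ i) (ℓ : ℝ) (η : Fin d → ℝ) :
    IsSymbol σ ℓ 0 (fun i x => sin (σ i ^ ℓ * ∑ a, η a * x a)) ∧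
    IsSymbol σ ℓ 0 (fun i x => cos (σ i ^ ℓ * ∑ a, η a * x a)) := by
  have hθ : ∀ i, ContDiff ℝ (⊤ : ℕ∞) (fun x : Fin d → ℝ => σ i ^ ℓ * ∑ a, η a * x a) := by
    intro i
    fun_prop
  have hpd : ∀ (a : Fin d) i x, pd a (fun x : Fin d → ℝ => σ i ^ ℓ * ∑ a, η a * x a) x
      = η a * σ i ^ ℓ := by
    intro a i x
    rw [pd_const_mul _ (by fun_prop), pd_linear, mul_comm]
  have hw : ∀ c : ℝ, IsSymbol (d := d) σ ℓ (0 + ℓ) (fun i _ => c * σ i ^ ℓ) := by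
    intro c
    rw [zero_add]
    exact weight hσ ℓ ℓ c
  have main : ∀ n, SymbolBound σ ℓ n 0 (fun i x => sin (σ i ^ ℓ * ∑ a, η a * x a)) ∧
      SymbolBound σ ℓ n 0 (fun i x => cos (σ i ^ ℓ * ∑ a, η a * x a)) := by
    intro n
    induction n with
    | zero =>
      exact ⟨⟨1, zero_le_one, fun i x => by simpa using abs_sin_le_one _⟩,
        ⟨1, zero_le_one, fun i x => by simpa using abs_cos_le_one _⟩⟩
    | succ n ih =>
      refine ⟨⟨⟨1, zero_le_one, fun i x => by simpa using abs_sin_le_one _⟩, fun a => ?_⟩,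
        ⟨⟨1, zero_le_one, fun i x => by simpa using abs_cos_le_one _⟩, fun a => ?_⟩⟩
      · have : (fun i => pd a (fun x => sin (σ i ^ ℓ * ∑ a, η a * x a)))
            = fun i x => cos (σ i ^ ℓ * ∑ a, η a * x a) * (η a * σ i ^ ℓ) := by
          funext i x
          rw [pd_sin ((hθ i).diffAt x), hpd]
        rw [this]
        have h := ih.2.mul hσ (fun i => (hθ i).cos) (hw (η a)).smooth ((hw (η a)).bound n)
        rwa [zero_add] at h
      · have : (fun i => pd a (fun x => cos (σ i ^ ℓ * ∑ a, η a * x a)))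
            = fun i x => sin (σ i ^ ℓ * ∑ a, η a * x a) * (-η a * σ i ^ ℓ) := by
          funext i x
          rw [pd_cos ((hθ i).diffAt x), hpd]
          ring
        rw [this]
        have h := ih.1.mul hσ (fun i => (hθ i).sin) (hw (-η a)).smooth ((hw (-η a)).bound n)
        rwa [zero_add] at h
  exact ⟨⟨fun i => (hθ i).sin, fun n => (main n).1⟩, ⟨fun i => (hθ i).cos, fun n => (main n).2⟩⟩

theorem of_hasCompactSupport {F : (Fin d → ℝ) → ℝ} (hF : ContDiff ℝ (⊤ : ℕ∞) F)
    (hc : HasCompactSupport F) : IsSymbol σ 0 0 (fun _ => F) := by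
  refine ⟨fun _ => hF, fun n => ?_⟩
  have key : ∀ F : (Fin d → ℝ) → ℝ, ContDiff ℝ (⊤ : ℕ∞) F → HasCompactSupport F →
      ∃ C, 0 ≤ C ∧ ∀ i x, |F x| ≤ C * σ i ^ (0 : ℝ) := by
    intro F hF hc
    obtain ⟨C, hC⟩ := hc.exists_bound_of_continuous hF.continuous
    exact ⟨|C|, abs_nonneg C, fun i x => by
      simpa using (hC x).trans (le_abs_self C)⟩
  induction n generalizing F with
  | zero => exact key F hF hc
  | succ n ih =>
    refine ⟨key F hF hc, fun a => ?_⟩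
    rw [add_zero]
    exact ih (contDiff_pd hF a) (hc.fderiv_apply ℝ _)

end IsSymbol

end Symbol

theorem exists_rankOne_decomposition (d : ℕ) :
    ∃ (η : Fin (d * (d + 1) / 2) → Fin d → ℝ) (L : Fin (d * (d + 1) / 2) → Fin d → Fin d → ℝ),
      ∀ M : Fin d → Fin d → ℝ, (∀ p q, M p q = M q p) →
        ∀ p q, M p q = ∑ i, (∑ a, ∑ b, L i a b * M a b) * (η i p * η i q) := by
  classical
  let I := {p : Fin d × Fin d // p.1 ≤ p.2}
  have hcard : Fintype.card I = d * (d + 1) / 2 := by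
    rw [← Fintype.card_congr (Sym2.sortEquiv (α := Fin d)), Sym2.card, Fintype.card_fin,
      Nat.choose_two_right, Nat.add_sub_cancel, mul_comm]
  let e : Fin (d * (d + 1) / 2) ≃ I := (finCongr hcard.symm).trans (Fintype.equivFin I).symm
  let η : I → Fin d → ℝ := fun x p =>
    if x.1.1 = x.1.2 then (if x.1.1 = p then 1 else 0)
    else (if x.1.1 = p then 1 else 0) + (if x.1.2 = p then 1 else 0)
  let L : I → Fin d → Fin d → ℝ := fun x a b =>
    if x.1.1 = x.1.2 then (if x.1.1 = a then (if a = b then 1 else -1) else 0)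
    else if x.1.1 = a then (if x.1.2 = b then 1 else 0) else 0
  refine ⟨fun i => η (e i), fun i => L (e i), fun M hM p q => ?_⟩
  rw [Equiv.sum_comp e fun x => (∑ a, ∑ b, L x a b * M a b) * (η x p * η x q)]
  have hsub : ∀ g : Fin d × Fin d → ℝ, ∑ x : I, g x.1 = ∑ a, ∑ b, if a ≤ b then g (a, b) else 0 := by
    intro g
    rw [← Fintype.sum_prod_type' (f := fun a b => if a ≤ b then g (a, b) else 0),
      ← Finset.sum_filter]
    exact (Finset.sum_subtype _ (by simp) g).symm
  have hL : ∀ x : I, ∑ a, ∑ b, L x a b * M a b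
      = if x.1.1 = x.1.2 then 2 * M x.1.1 x.1.1 - ∑ b, M x.1.1 b else M x.1.1 x.1.2 := by
    intro x
    split_ifs with hx
    · have : ∀ b, (if x.1.1 = b then (1 : ℝ) else -1) * M x.1.1 b
          = 2 * (if x.1.1 = b then M x.1.1 b else 0) - M x.1.1 b := by
        intro b
        split_ifs <;> ring
      simp only [L, if_pos hx, ite_mul, zero_mul]
      rw [Finset.sum_eq_single x.1.1 (fun b _ hb => by simp [hb.symm]) (by simp)]
      simp only [← ite_mul, if_true, this, Finset.sum_sub_distrib, ← Finset.mul_sum]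
      simp
    · simp [L, if_neg hx]
  let g : Fin d → Fin d → ℝ := fun a b => M a b *
    (((if a = p then 1 else 0) + (if b = p then 1 else 0)) *
      ((if a = q then 1 else 0) + (if b = q then 1 else 0)))
  let D : Fin d → ℝ := fun a => (2 * M a a - ∑ b, M a b) *
    ((if a = p then 1 else 0) * (if a = q then 1 else 0))
  have hg : ∀ a b, g a b = g b a := by
    intro a b
    simp only [g, hM a b]
    ring
  have hG : ∀ x : I, (∑ a, ∑ b, L x a b * M a b) * (η x p * η x q)
      = if x.1.1 = x.1.2 then D x.1.1 else g x.1.1 x.1.2 := by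
    intro x
    rw [hL]
    split_ifs with hx
    · simp only [D, η, if_pos hx]
    · simp only [g, η, if_neg hx]
  rw [Finset.sum_congr rfl fun x _ => hG x, hsub fun y => if y.1 = y.2 then D y.1 else g y.1 y.2]
  have hsym : 2 * ∑ a, ∑ b, (if a ≤ b then (if a = b then D a else g a b) else 0)
      = ∑ a, ∑ b, g a b + ∑ a, (2 * D a - g a a) := by
    have hdiag : ∀ a, 2 * D a - g a a = ∑ b, if a = b then 2 * D a - g a a else 0 := by
      intro a
      simp
    rw [two_mul]
    nth_rewrite 2 [Finset.sum_comm]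
    rw [Finset.sum_congr rfl fun a _ => hdiag a, ← Finset.sum_add_distrib,
      ← Finset.sum_add_distrib]
    refine Finset.sum_congr rfl fun a _ => ?_
    rw [← Finset.sum_add_distrib, ← Finset.sum_add_distrib]
    refine Finset.sum_congr rfl fun b _ => ?_
    rcases lt_trichotomy a b with h | h | h
    · simp [h.le, h.ne, h.not_ge]
    · subst h
      simp
      ring
    · simp [h.le, h.ne, h.ne', h.not_ge, hg a b]
  have hsum : ∑ a, ∑ b, g a b = 2 * M p q + 2 * if p = q then ∑ b, M p b else 0 := by
    have : ∀ a b, g a b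
        = (if a = p then (if a = q then M a b else 0) else 0)
          + (if b = p then (if b = q then M b a else 0) else 0)
          + (if a = p then (if b = q then M a b else 0) else 0)
          + (if a = q then (if b = p then M b a else 0) else 0) := by
      intro a b
      simp only [g, hM b a]
      split_ifs <;> ring
    simp only [this, Finset.sum_add_distrib, Finset.sum_ite_irrel, Finset.sum_const_zero,
      Finset.sum_ite_eq', Finset.mem_univ, if_true]
    split_ifs <;> ring
  have hsum' : ∑ a, (2 * D a - g a a) = -2 * if p = q then ∑ b, M p b else 0 := by
    have : ∀ a, 2 * D a - g a a
        = if a = p then (if a = q then -2 * ∑ b, M a b else 0) else 0 := by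
      intro a
      simp only [g, D]
      split_ifs <;> ring
    simp only [this, Finset.sum_ite_eq', Finset.mem_univ, if_true]
    split_ifs <;> ring
  linarith

/-- The mismatch between the target metric `T` and the one induced by `v` and `w` to leading
order. -/
def gramError {d k : ℕ} (T : Fin d → Fin d → (Fin d → ℝ) → ℝ) (v : Fin k → (Fin d → ℝ) → ℝ)
    (w : Fin d → (Fin d → ℝ) → ℝ) (p r : Fin d) (x : Fin d → ℝ) : ℝ :=
  T p r x - 1 / 2 * ∑ j, pd p (v j) x * pd r (v j) x - 1 / 2 * (pd r (w p) x + pd p (w r) x)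

/-- The oscillation added to the out-of-plane displacement. -/
def corrugation {d : ℕ} (lam : ℝ) (η : Fin d → ℝ) (a : (Fin d → ℝ) → ℝ) (x : Fin d → ℝ) : ℝ :=
  2 * (lam⁻¹ * (a x * sin (lam * ∑ b, η b * x b)))

/-- The in-plane displacement that is subtracted to compensate for the mixed terms created by a
corrugation. -/
def inPlaneCorrection {d : ℕ} (lam : ℝ) (η : Fin d → ℝ) (a V : (Fin d → ℝ) → ℝ) (p : Fin d)
    (x : Fin d → ℝ) : ℝ :=
  corrugation lam η a x * pd p V x
    + η p * (lam⁻¹ * ((a x * a x) *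
        (sin (lam * ∑ b, η b * x b) * cos (lam * ∑ b, η b * x b))))
    - 1 / 4 * ((lam⁻¹ * lam⁻¹) *
        ((1 - 2 * (sin (lam * ∑ b, η b * x b) * sin (lam * ∑ b, η b * x b)))
          * pd p (fun y => a y * a y) x))

section Corrugation

variable {d : ℕ} {lam : ℝ} {η : Fin d → ℝ} {a V : (Fin d → ℝ) → ℝ}

theorem contDiff_corrugation (ha : ContDiff ℝ (⊤ : ℕ∞) a) :
    ContDiff ℝ (⊤ : ℕ∞) (corrugation lam η a) := by
  unfold corrugation
  fun_prop

theorem contDiff_inPlaneCorrection (ha : ContDiff ℝ (⊤ : ℕ∞) a) (hV : ContDiff ℝ (⊤ : ℕ∞) V)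
    (p : Fin d) : ContDiff ℝ (⊤ : ℕ∞) (inPlaneCorrection lam η a V p) := by
  have h1 := contDiff_corrugation (lam := lam) (η := η) ha
  have h2 := contDiff_pd hV p
  have h3 := contDiff_pd (ha.mul ha) p
  unfold inPlaneCorrection
  fun_prop

theorem pd_corrugation (hlam : lam ≠ 0) (ha : ContDiff ℝ (⊤ : ℕ∞) a) (p : Fin d)
    (x : Fin d → ℝ) :
    pd p (corrugation lam η a) x
      = 2 * lam⁻¹ * pd p a x * sin (lam * ∑ b, η b * x b)
        + 2 * a x * cos (lam * ∑ b, η b * x b) * η p := by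
  have ha' := ha.diffAt x
  unfold corrugation
  rw [pd_const_mul _ (by fun_prop), pd_const_mul _ (by fun_prop), pd_mul ha' (by fun_prop),
    pd_sin (by fun_prop), pd_const_mul _ (by fun_prop), pd_linear]
  field_simp

theorem pd_inPlaneCorrection (hlam : lam ≠ 0) (ha : ContDiff ℝ (⊤ : ℕ∞) a)
    (hV : ContDiff ℝ (⊤ : ℕ∞) V) (p r : Fin d) (x : Fin d → ℝ) :
    pd r (inPlaneCorrection lam η a V p) x
      = pd r (corrugation lam η a) x * pd p V x + corrugation lam η a x * pd r (pd p V) x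
        + lam⁻¹ * η p * pd r (fun y => a y * a y) x
          * (sin (lam * ∑ b, η b * x b) * cos (lam * ∑ b, η b * x b))
        + a x * a x * η p * η r
          * (cos (lam * ∑ b, η b * x b) ^ 2 - sin (lam * ∑ b, η b * x b) ^ 2)
        + lam⁻¹ * η r * pd p (fun y => a y * a y) x
          * (sin (lam * ∑ b, η b * x b) * cos (lam * ∑ b, η b * x b))
        - 1 / 4 * lam⁻¹ ^ 2 * (1 - 2 * sin (lam * ∑ b, η b * x b) ^ 2)
          * pd r (pd p (fun y => a y * a y)) x := by
  have ha' := ha.diffAt x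
  have h1 := (contDiff_corrugation (lam := lam) (η := η) ha).diffAt x
  have h2 := (contDiff_pd hV p).diffAt x
  have h3 := (contDiff_pd (ha.mul ha) p).diffAt x
  have hs : pd r (fun x : Fin d → ℝ => sin (lam * ∑ b, η b * x b)) x
      = cos (lam * ∑ b, η b * x b) * (lam * η r) := by
    rw [pd_sin (by fun_prop), pd_const_mul _ (by fun_prop), pd_linear]
  have hc : pd r (fun x : Fin d → ℝ => cos (lam * ∑ b, η b * x b)) x
      = -sin (lam * ∑ b, η b * x b) * (lam * η r) := by
    rw [pd_cos (by fun_prop), pd_const_mul _ (by fun_prop), pd_linear]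
  have hA := (ha.mul ha).diffAt x
  have hsc : pd r (fun x : Fin d → ℝ => sin (lam * ∑ b, η b * x b) * cos (lam * ∑ b, η b * x b)) x
      = (lam * η r) * (cos (lam * ∑ b, η b * x b) ^ 2 - sin (lam * ∑ b, η b * x b) ^ 2) := by
    rw [pd_mul (by fun_prop) (by fun_prop), hs, hc]
    ring
  have hss : pd r (fun x : Fin d → ℝ =>
      1 - 2 * (sin (lam * ∑ b, η b * x b) * sin (lam * ∑ b, η b * x b))) x
      = -4 * (lam * η r) * (sin (lam * ∑ b, η b * x b) * cos (lam * ∑ b, η b * x b)) := by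
    rw [pd_sub (by fun_prop) (by fun_prop), pd_const, pd_const_mul _ (by fun_prop),
      pd_mul (by fun_prop) (by fun_prop), hs]
    ring
  unfold inPlaneCorrection
  rw [pd_sub (by fun_prop) (by fun_prop), pd_add (by fun_prop) (by fun_prop), pd_mul h1 h2,
    pd_const_mul _ (by fun_prop), pd_const_mul _ (by fun_prop), pd_const_mul _ (by fun_prop),
    pd_const_mul _ (by fun_prop), pd_mul (by fun_prop) h3, hss,
    pd_mul (f := fun y => a y * a y) hA (by fun_prop), hsc]
  field_simp
  ring

theorem corrugation_identity (hlam : lam ≠ 0) (ha : ContDiff ℝ (⊤ : ℕ∞) a)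
    (hV : ContDiff ℝ (⊤ : ℕ∞) V) (p r : Fin d) (x : Fin d → ℝ) :
    1 / 2 * ((pd p V x + pd p (corrugation lam η a) x) * (pd r V x + pd r (corrugation lam η a) x)
        - pd p V x * pd r V x)
      - 1 / 2 * (pd r (inPlaneCorrection lam η a V p) x + pd p (inPlaneCorrection lam η a V r) x)
    = a x * a x * (η p * η r)
      - 1 / 2 * (corrugation lam η a x * (pd r (pd p V) x + pd p (pd r V) x))
      + 2 * ((lam⁻¹ * lam⁻¹) * ((sin (lam * ∑ b, η b * x b) * sin (lam * ∑ b, η b * x b))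
          * (pd p a x * pd r a x)))
      + 1 / 8 * ((lam⁻¹ * lam⁻¹) *
          ((1 - 2 * (sin (lam * ∑ b, η b * x b) * sin (lam * ∑ b, η b * x b)))
          * (pd r (pd p (fun y => a y * a y)) x + pd p (pd r (fun y => a y * a y)) x))) := by
  have hA : ∀ b, pd b (fun y => a y * a y) x = 2 * a x * pd b a x := by
    intro b
    rw [pd_mul (ha.diffAt x) (ha.diffAt x)]
    ring
  rw [pd_inPlaneCorrection hlam ha hV, pd_inPlaneCorrection hlam ha hV,
    pd_corrugation hlam ha, pd_corrugation hlam ha, hA, hA]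
  have hsc := sin_sq_add_cos_sq (lam * ∑ b, η b * x b)
  linear_combination (a x * a x * η p * η r) * hsc

end Corrugation

namespace IsSymbol

variable {d k : ℕ} {ι : Type*} {σ : ι → ℝ} {ℓ ℓa ma μ e : ℝ} {a V : ι → (Fin d → ℝ) → ℝ}

theorem inv_weight (hσ : ∀ i, 1 ≤ σ i) (ℓ : ℝ) :
    IsSymbol (d := d) σ ℓ (-ℓ) (fun i _ => (σ i ^ ℓ)⁻¹) := by
  have := weight (d := d) hσ ℓ (-ℓ) 1
  simpa only [one_mul, Real.rpow_neg (zero_le_one.trans (hσ _))] using this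

theorem corrugation (hσ : ∀ i, 1 ≤ σ i) (ha : IsSymbol σ ℓa ma a) (hℓ : ℓa ≤ ℓ) (η : Fin d → ℝ) :
    IsSymbol σ ℓ (ma - ℓ) (fun i => corrugation (σ i ^ ℓ) η (a i)) := by
  have h := ((inv_weight (d := d) hσ ℓ).mul hσ
    ((ha.mono hσ le_rfl hℓ).mul hσ (sin_cos hσ ℓ η).1)).const_mul hσ 2
  exact h.mono hσ (by linarith) le_rfl

theorem inPlaneCorrection (hσ : ∀ i, 1 ≤ σ i) (ha : IsSymbol σ ℓa ma a) (hℓ : ℓa ≤ ℓ)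
    (hma : ma ≤ 0) (η : Fin d → ℝ) (p : Fin d) (hV : IsSymbol σ ℓ 0 (fun i => pd p (V i))) :
    IsSymbol σ ℓ (ma - ℓ) (fun i => inPlaneCorrection (σ i ^ ℓ) η (a i) (V i) p) := by
  obtain ⟨hs, hc⟩ := sin_cos hσ ℓ η
  have hw := inv_weight (d := d) hσ ℓ
  have ha2 := ha.mul hσ ha
  have h1 := ((ha.corrugation hσ hℓ η).mul hσ hV).mono hσ (m' := ma - ℓ) (by linarith) le_rfl
  have h2 := ((hw.mul hσ ((ha2.mono hσ le_rfl hℓ).mul hσ (hs.mul hσ hc))).const_mul hσ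
    (η p)).mono hσ (m' := ma - ℓ) (by linarith) le_rfl
  have hss := ((const (d := d) hσ ℓ 1).sub hσ (((hs.mul hσ hs).const_mul hσ 2).mono hσ
    (add_zero 0).le le_rfl))
  have h3 := (((hw.mul hσ hw).mul hσ (hss.mul hσ ((ha2.pderiv p).mono hσ le_rfl hℓ))).const_mul hσ
    (1 / 4)).mono hσ (m' := ma - ℓ) (by linarith) le_rfl
  exact (h1.add h2).sub hσ h3

theorem gramError_update (hσ : ∀ i, 1 ≤ σ i) (T : Fin d → Fin d → (Fin d → ℝ) → ℝ)
    {v : Fin k → ι → (Fin d → ℝ) → ℝ} {w : Fin d → ι → (Fin d → ℝ) → ℝ}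
    (hv : ∀ j i, ContDiff ℝ (⊤ : ℕ∞) (v j i)) (hw : ∀ p i, ContDiff ℝ (⊤ : ℕ∞) (w p i))
    (ha : IsSymbol σ ℓa ma a) (hℓ : ℓa ≤ ℓ) (η : Fin d → ℝ) (j : Fin k)
    (hVV : ∀ p r, IsSymbol σ ℓ μ (fun i => pd r (pd p (v j i))))
    (h1 : ma - ℓ + μ ≤ e) (h2 : 2 * ma - 2 * ℓ + 2 * ℓa ≤ e) (p r : Fin d) :
    IsSymbol σ ℓ e (fun i x =>
      gramError T (fun j' => Function.update v j
          (fun i x => v j i x + _root_.corrugation (σ i ^ ℓ) η (a i) x) j' i)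
        (fun q x => w q i x - _root_.inPlaneCorrection (σ i ^ ℓ) η (a i) (v j i) q x) p r x
      - (gramError T (fun j' => v j' i) (fun q => w q i) p r x
        - a i x * a i x * (η p * η r))) := by
  obtain ⟨hs, -⟩ := sin_cos hσ ℓ η
  have hwt := inv_weight (d := d) hσ ℓ
  have ha2 := ha.mul hσ ha
  have e1 := ((((ha.corrugation hσ hℓ η).mul hσ ((hVV p r).add (hVV r p)))).const_mul hσ
    (1 / 2)).mono hσ h1 le_rfl
  have e2 := (((hwt.mul hσ hwt).mul hσ ((hs.mul hσ hs).mul hσ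
    (((ha.pderiv p).mul hσ (ha.pderiv r)).mono hσ le_rfl hℓ))).const_mul hσ 2).mono hσ (m' := e)
    (by linarith) le_rfl
  have hss := ((const (d := d) hσ ℓ 1).sub hσ (((hs.mul hσ hs).const_mul hσ 2).mono hσ
    (add_zero 0).le le_rfl))
  have e3 := (((hwt.mul hσ hwt).mul hσ (hss.mul hσ ((((ha2.pderiv p).pderiv r).add
    ((ha2.pderiv r).pderiv p)).mono hσ le_rfl hℓ))).const_mul hσ (1 / 8)).mono hσ (m' := e)
    (by linarith) le_rfl
  convert (e1.sub hσ e2).sub hσ e3 using 1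
  funext i x
  have hlam : σ i ^ ℓ ≠ 0 := (Real.rpow_pos_of_pos (one_pos.trans_le (hσ i)) ℓ).ne'
  have hsum : ∑ j', pd p (Function.update v j
          (fun i x => v j i x + _root_.corrugation (σ i ^ ℓ) η (a i) x) j' i) x
        * pd r (Function.update v j
          (fun i x => v j i x + _root_.corrugation (σ i ^ ℓ) η (a i) x) j' i) x
      = ∑ j', pd p (v j' i) x * pd r (v j' i) x
        + ((pd p (v j i) x + pd p (_root_.corrugation (σ i ^ ℓ) η (a i)) x)
          * (pd r (v j i) x + pd r (_root_.corrugation (σ i ^ ℓ) η (a i)) x)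
          - pd p (v j i) x * pd r (v j i) x) := by
    rw [← sub_eq_iff_eq_add', ← Finset.sum_sub_distrib,
      Finset.sum_eq_single j (fun j' _ hj => by simp [hj]) (by simp), Function.update_self,
      pd_add ((hv j i).diffAt x) ((contDiff_corrugation (ha.smooth i)).diffAt x),
      pd_add ((hv j i).diffAt x) ((contDiff_corrugation (ha.smooth i)).diffAt x)]
  have hid := corrugation_identity (η := η) hlam (ha.smooth i) (hv j i) p r x
  have hws : ∀ q q', pd q' (fun x => w q i x
      - _root_.inPlaneCorrection (σ i ^ ℓ) η (a i) (v j i) q x) x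
      = pd q' (w q i) x - pd q' (_root_.inPlaneCorrection (σ i ^ ℓ) η (a i) (v j i) q) x :=
    fun q q' => pd_sub ((hw q i).diffAt x)
      ((contDiff_inPlaneCorrection (ha.smooth i) (hv j i) q).diffAt x) q'
  simp only [gramError]
  rw [hsum, hws, hws]
  linear_combination -hid

end IsSymbol

/-- Bounds on the out-of-plane and in-plane displacements after `n` corrugations, the last one
having frequency `σ ^ F`. -/
structure CorrugationBounds {d k : ℕ} {ι : Type*} (σ : ι → ℝ) (c : ℝ) (n : ℕ) (F : ℝ)
    (v : Fin k → ι → (Fin d → ℝ) → ℝ) (w : Fin d → ι → (Fin d → ℝ) → ℝ) : Prop where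
  smooth_v : ∀ j i, ContDiff ℝ (⊤ : ℕ∞) (v j i)
  smooth_w : ∀ p i, ContDiff ℝ (⊤ : ℕ∞) (w p i)
  pd_v : ∀ j r, IsSymbol σ F 0 (fun i => pd r (v j i))
  pd_pd_v : ∀ (m : ℕ), n ≤ m → ∀ j : Fin k, j.val = m % k → ∀ p r,
    IsSymbol σ F (m * c - 1 / 2) (fun i => pd r (pd p (v j i)))
  pd_w : ∀ p r, IsSymbol σ F 0 (fun i => pd r (w p i))
  pd_pd_w : ∀ q p r, IsSymbol σ F (n * c + 1 / 2) (fun i => pd r (pd p (w q i)))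

namespace CorrugationBounds

variable {d k : ℕ} {ι : Type*} {σ : ι → ℝ} {c F : ℝ} {n : ℕ}
  {v : Fin k → ι → (Fin d → ℝ) → ℝ} {w : Fin d → ι → (Fin d → ℝ) → ℝ}

theorem mono (hσ : ∀ i, 1 ≤ σ i) (h : CorrugationBounds σ c n F v w) {F' : ℝ} (hF : F ≤ F') :
    CorrugationBounds σ c n F' v w :=
  ⟨h.smooth_v, h.smooth_w, fun j r => (h.pd_v j r).mono hσ le_rfl hF,
    fun m hm j hj p r => (h.pd_pd_v m hm j hj p r).mono hσ le_rfl hF,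
    fun p r => (h.pd_w p r).mono hσ le_rfl hF, fun q p r => (h.pd_pd_w q p r).mono hσ le_rfl hF⟩

theorem zero (hσ : ∀ i, 1 ≤ σ i) :
    CorrugationBounds σ c n F (fun (_ : Fin k) _ _ => 0) (fun (_ : Fin d) _ _ => 0) := by
  have h1 : ∀ r, pd r (fun _ : Fin d → ℝ => (0 : ℝ)) = fun _ => 0 := by
    intro r
    funext x
    exact pd_const 0 r
  refine ⟨fun _ _ => contDiff_const, fun _ _ => contDiff_const, fun _ _ => ?_,
    fun _ _ _ _ _ _ => ?_, fun _ _ => ?_, fun _ _ _ => ?_⟩ <;>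
  simpa only [h1] using IsSymbol.zero hσ _ _

theorem corrugate (hσ : ∀ i, 1 ≤ σ i) (hc : 0 ≤ c) (hkc : 1 ≤ k * c)
    (h : CorrugationBounds σ c n F v w) {ℓ ℓa ma : ℝ} {a : ι → (Fin d → ℝ) → ℝ}
    (ha : IsSymbol σ ℓa ma a) (hℓ : ℓa ≤ ℓ) (hF : F ≤ ℓ) (hma : ma ≤ 0)
    (hn : ma + ℓ ≤ n * c + 1 / 2) (η : Fin d → ℝ) (j : Fin k) (hj : j.val = n % k) :
    CorrugationBounds σ c (n + 1) ℓ
      (Function.update v j (fun i x => v j i x + corrugation (σ i ^ ℓ) η (a i) x))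
      (fun q i x => w q i x - inPlaneCorrection (σ i ^ ℓ) η (a i) (v j i) q x) := by
  replace h := h.mono hσ hF
  have hφ := ha.corrugation hσ hℓ η
  have hψ : ∀ q, IsSymbol σ ℓ (ma - ℓ)
      (fun i => inPlaneCorrection (σ i ^ ℓ) η (a i) (v j i) q) := fun q =>
    ha.inPlaneCorrection hσ hℓ hma η q (h.pd_v j q)
  have hv1 : ∀ p i, pd p (fun x => v j i x + corrugation (σ i ^ ℓ) η (a i) x)
      = fun x => pd p (v j i) x + pd p (corrugation (σ i ^ ℓ) η (a i)) x := fun p i =>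
    funext fun x => pd_add ((h.smooth_v j i).diffAt x) ((hφ.smooth i).diffAt x) p
  have hv2 : ∀ p r i, pd r (fun x => pd p (v j i) x + pd p (corrugation (σ i ^ ℓ) η (a i)) x)
      = fun x => pd r (pd p (v j i)) x + pd r (pd p (corrugation (σ i ^ ℓ) η (a i))) x :=
    fun p r i => funext fun x => pd_add ((contDiff_pd (h.smooth_v j i) p).diffAt x)
      ((contDiff_pd (hφ.smooth i) p).diffAt x) r
  have hw1 : ∀ q p i, pd p (fun x => w q i x - inPlaneCorrection (σ i ^ ℓ) η (a i) (v j i) q x)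
      = fun x => pd p (w q i) x - pd p (inPlaneCorrection (σ i ^ ℓ) η (a i) (v j i) q) x :=
    fun q p i => funext fun x => pd_sub ((h.smooth_w q i).diffAt x) (((hψ q).smooth i).diffAt x) p
  have hw2 : ∀ q p r i, pd r (fun x => pd p (w q i) x
        - pd p (inPlaneCorrection (σ i ^ ℓ) η (a i) (v j i) q) x)
      = fun x => pd r (pd p (w q i)) x
        - pd r (pd p (inPlaneCorrection (σ i ^ ℓ) η (a i) (v j i) q)) x :=
    fun q p r i => funext fun x => pd_sub ((contDiff_pd (h.smooth_w q i) p).diffAt x)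
      ((contDiff_pd ((hψ q).smooth i) p).diffAt x) r
  refine ⟨fun j' i => ?_, fun p i => (h.smooth_w p i).sub ((hψ p).smooth i), fun j' r => ?_,
    fun m hm j' hj' p r => ?_, fun p r => ?_, fun q p r => ?_⟩
  · rcases eq_or_ne j' j with rfl | hne
    · rw [Function.update_self]
      exact (h.smooth_v j' i).add (hφ.smooth i)
    · rw [Function.update_of_ne hne]
      exact h.smooth_v j' i
  · rcases eq_or_ne j' j with rfl | hne
    · simp only [Function.update_self, hv1]
      exact (h.pd_v j' r).add ((hφ.pderiv r).mono hσ (by linarith) le_rfl)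
    · simp only [Function.update_of_ne hne]
      exact h.pd_v j' r
  · rcases eq_or_ne j' j with rfl | hne
    · simp only [Function.update_self, hv1, hv2]
      refine (h.pd_pd_v m (by omega) j' hj' p r).add
        (((hφ.pderiv p).pderiv r).mono hσ ?_ le_rfl)
      have hk : n + k ≤ m := by
        have hdvd : k ∣ m - n := (Nat.modEq_iff_dvd' (by omega)).1 (hj.symm.trans hj')
        have := Nat.le_of_dvd (by omega) hdvd
        omega
      have hk' : (n : ℝ) + k ≤ m := mod_cast hk
      nlinarith
    · simp only [Function.update_of_ne hne]
      exact h.pd_pd_v m (by omega) j' hj' p r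
  · simp only [hw1]
    exact (h.pd_w p r).sub hσ (((hψ p).pderiv r).mono hσ (by linarith) le_rfl)
  · simp only [hw1, hw2]
    push_cast
    exact ((h.pd_pd_w q p r).mono hσ (by linarith) le_rfl).sub hσ
      ((((hψ q).pderiv p).pderiv r).mono hσ (by linarith) le_rfl)

end CorrugationBounds

section Stage

variable {d k : ℕ} {ι : Type*} {σ : ι → ℝ} {c : ℝ} {T : Fin d → Fin d → (Fin d → ℝ) → ℝ}

/-- A sum of rank-one errors is removed by corrugations of increasing frequencies. -/
theorem exists_corrugate_sum (hσ : ∀ i, 1 ≤ σ i) (hk : 1 ≤ k) (hc : 0 ≤ c) (hkc : 1 ≤ k * c)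
    {D q : ℕ} {v : Fin k → ι → (Fin d → ℝ) → ℝ} {w : Fin d → ι → (Fin d → ℝ) → ℝ} {F : ℝ}
    (hF : F = q * D * c + q / 2)
    (h : CorrugationBounds σ c (q * D) F v w) {a : Fin D → ι → (Fin d → ℝ) → ℝ}
    (ha : ∀ m, IsSymbol σ F (-(q / 2 : ℝ)) (a m)) (η : Fin D → Fin d → ℝ)
    (hG : ∀ p r i x, gramError T (fun j => v j i) (fun p => w p i) p r x
      = ∑ m, a m i x * a m i x * (η m p * η m r)) {n : ℕ} (hn : n ≤ D) :
    ∃ (v' : Fin k → ι → (Fin d → ℝ) → ℝ) (w' : Fin d → ι → (Fin d → ℝ) → ℝ),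
      CorrugationBounds σ c (q * D + n) (F + n * c + 1 / 2) v' w' ∧
      ∀ p r, IsSymbol σ (F + n * c + 1 / 2) (-((q : ℝ) + 1)) (fun i x =>
        gramError T (fun j => v' j i) (fun p => w' p i) p r x
          - ∑ m with n ≤ m.val, a m i x * a m i x * (η m p * η m r)) := by
  induction n with
  | zero =>
    refine ⟨v, w, h.mono hσ (by push_cast; linarith), fun p r => ?_⟩
    simpa [hG] using IsSymbol.zero hσ _ _
  | succ n ih =>
    obtain ⟨v', w', hb, hE⟩ := ih (by omega)
    have hnc : 0 ≤ n * c := by positivity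
    have hFn : F ≤ F + n * c + 1 / 2 := by linarith
    have hmono : F + n * c + 1 / 2 ≤ F + (n + 1 : ℕ) * c + 1 / 2 := by
      push_cast
      linarith
    have hq : (0 : ℝ) ≤ q := q.cast_nonneg
    let m : Fin D := ⟨n, hn⟩
    let j : Fin k := ⟨(q * D + n) % k, Nat.mod_lt _ hk⟩
    refine ⟨_, _, (hb.corrugate hσ hc hkc (ha m) hFn le_rfl (by linarith)
      (by push_cast; linarith) (η m) j rfl).mono hσ hmono, fun p r => ?_⟩
    have h1 := (IsSymbol.gramError_update (e := -((q : ℝ) + 1)) hσ T hb.smooth_v hb.smooth_w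
      (ha m) hFn (η m) j
      (hb.pd_pd_v _ le_rfl j rfl) (by push_cast; linarith) (by linarith) p r).add (hE p r)
    refine IsSymbol.mono hσ ?_ le_rfl hmono
    convert h1 using 1
    funext i x
    have hset : (Finset.univ.filter fun m' : Fin D => n ≤ m'.val)
        = insert m (Finset.univ.filter fun m' : Fin D => n + 1 ≤ m'.val) := by
      ext m'
      simp only [Finset.mem_filter, Finset.mem_univ, true_and, Finset.mem_insert, Fin.ext_iff, m]
      omega
    rw [hset, Finset.sum_insert (by simp [m])]
    ring

/-- One stage of the iteration: the mismatch gains a factor `σ⁻¹`. -/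
theorem exists_stage (hσ : ∀ i, 1 ≤ σ i) (hk : 1 ≤ k) (hc : 0 ≤ c) (hkc : 1 ≤ k * c)
    (hT : ∀ p r, T p r = T r p) {q : ℕ}
    {v : Fin k → ι → (Fin d → ℝ) → ℝ} {w : Fin d → ι → (Fin d → ℝ) → ℝ} {F : ℝ}
    (hF : F = q * ((d * (d + 1) / 2 : ℕ) : ℝ) * c + q / 2)
    (h : CorrugationBounds σ c (q * (d * (d + 1) / 2)) F v w)
    (hG : ∀ p r, IsSymbol σ F (-(q : ℝ)) (fun i x =>
      gramError T (fun j => v j i) (fun p => w p i) p r x)) :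
    ∃ (v' : Fin k → ι → (Fin d → ℝ) → ℝ) (w' : Fin d → ι → (Fin d → ℝ) → ℝ),
      CorrugationBounds σ c ((q + 1) * (d * (d + 1) / 2))
        (F + ((d * (d + 1) / 2 : ℕ) : ℝ) * c + 1 / 2) v' w' ∧
      ∀ p r, IsSymbol σ (F + ((d * (d + 1) / 2 : ℕ) : ℝ) * c + 1 / 2) (-((q : ℝ) + 1))
        (fun i x => gramError T (fun j => v' j i) (fun p => w' p i) p r x) := by
  obtain ⟨η, L, hηL⟩ := exists_rankOne_decomposition d
  have hpos : ∀ i, 0 < σ i := fun i => one_pos.trans_le (hσ i)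
  have hcoeff : ∀ m, IsSymbol σ F (-(q : ℝ)) (fun i x => ∑ a, ∑ b, L m a b *
      gramError T (fun j => v j i) (fun p => w p i) a b x) := fun m =>
    IsSymbol.sum hσ _ fun a _ => IsSymbol.sum hσ _ fun b _ => (hG a b).const_mul hσ _
  choose C hC hCb using fun m => (hcoeff m).exists_bound
  let base : Fin (d * (d + 1) / 2) → ι → (Fin d → ℝ) → ℝ := fun m i x =>
    (C m + 1) + 1 * σ i ^ (q : ℝ) *
      ∑ a, ∑ b, L m a b * gramError T (fun j => v j i) (fun p => w p i) a b x
  have hbase1 : ∀ m i x, 1 ≤ base m i x := by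
    intro m i x
    have h1 := (abs_le.1 (hCb m i x)).1
    have hp : 0 < σ i ^ (q : ℝ) := Real.rpow_pos_of_pos (hpos i) _
    have h2 : σ i ^ (q : ℝ) * σ i ^ (-(q : ℝ)) = 1 := by
      rw [← Real.rpow_add (hpos i), add_neg_cancel, Real.rpow_zero]
    have h3 := mul_le_mul_of_nonneg_left h1 hp.le
    have h4 : σ i ^ (q : ℝ) * -(C m * σ i ^ (-(q : ℝ))) = -C m := by
      linear_combination (-C m) * h2
    simp only [base]
    linarith
  have hbase : ∀ m, IsSymbol σ F 0 (base m) := fun m =>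
    (IsSymbol.const hσ F (C m + 1)).add
      (((IsSymbol.weight hσ F (q : ℝ) 1).mul hσ (hcoeff m)).mono hσ (by linarith) le_rfl)
  let a : Fin (d * (d + 1) / 2) → ι → (Fin d → ℝ) → ℝ := fun m i x =>
    1 * σ i ^ (-(q / 2 : ℝ)) * base m i x ^ (1 / 2 : ℝ)
  have ha : ∀ m, IsSymbol σ F (-(q / 2 : ℝ)) (a m) := fun m =>
    ((IsSymbol.weight hσ F (-(q / 2 : ℝ)) 1).mul hσ
      ((hbase m).rpow_const hσ (hbase1 m) (1 / 2))).mono hσ (by linarith) le_rfl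
  have haa : ∀ m i x, a m i x * a m i x = (C m + 1) * σ i ^ (-(q : ℝ)) +
      ∑ a, ∑ b, L m a b * gramError T (fun j => v j i) (fun p => w p i) a b x := by
    intro m i x
    have h1 : σ i ^ (-(q / 2 : ℝ)) * σ i ^ (-(q / 2 : ℝ)) = σ i ^ (-(q : ℝ)) := by
      rw [← Real.rpow_add (hpos i)]
      congr 1
      ring
    have h0 : 0 < base m i x := one_pos.trans_le (hbase1 m i x)
    have h2 : base m i x ^ (1 / 2 : ℝ) * base m i x ^ (1 / 2 : ℝ) = base m i x := by
      rw [← Real.rpow_add h0]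
      norm_num
    have h3 : σ i ^ (-(q : ℝ)) * σ i ^ (q : ℝ) = 1 := by
      rw [← Real.rpow_add (hpos i), neg_add_cancel, Real.rpow_zero]
    calc a m i x * a m i x
        = (σ i ^ (-(q / 2 : ℝ)) * σ i ^ (-(q / 2 : ℝ)))
          * (base m i x ^ (1 / 2 : ℝ) * base m i x ^ (1 / 2 : ℝ)) := by simp only [a]; ring
      _ = _ := by
        rw [h1, h2]
        simp only [base]
        linear_combination (∑ a, ∑ b, L m a b *
          gramError T (fun j => v j i) (fun p => w p i) a b x) * h3
  let A : Fin d → Fin d → ℝ := fun p r => ∑ m, (C m + 1) * (η m p * η m r)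
  have hA : ∀ p r, A p r = A r p := fun p r =>
    Finset.sum_congr rfl fun m _ => by ring
  have hws : ∀ p r i, pd r (fun x => w p i x - σ i ^ (-(q : ℝ)) * ∑ b, A p b * x b)
      = fun x => pd r (w p i) x - A p r * σ i ^ (-(q : ℝ)) := by
    intro p r i
    funext x
    rw [pd_sub ((h.smooth_w p i).diffAt x) (by fun_prop), pd_const_mul _ (by fun_prop), pd_linear,
      mul_comm]
  have hws' : ∀ p r r' i, pd r' (fun x => pd r (w p i) x - A p r * σ i ^ (-(q : ℝ)))
      = pd r' (pd r (w p i)) := by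
    intro p r r' i
    funext x
    rw [pd_sub ((contDiff_pd (h.smooth_w p i) r).diffAt x) (by fun_prop), pd_const, sub_zero]
  have h' : CorrugationBounds σ c (q * (d * (d + 1) / 2)) F v
      (fun p i x => w p i x - σ i ^ (-(q : ℝ)) * ∑ b, A p b * x b) := by
    refine ⟨h.smooth_v, fun p i => (h.smooth_w p i).sub (by fun_prop), h.pd_v, h.pd_pd_v,
      fun p r => ?_, fun p r r' => ?_⟩
    · simp only [hws]
      exact (h.pd_w p r).sub hσ ((IsSymbol.weight hσ F (-(q : ℝ)) (A p r)).mono hσ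
        (by simp) le_rfl)
    · simp only [hws, hws']
      exact h.pd_pd_w p r r'
  have hG' : ∀ p r i x, gramError T (fun j => v j i)
      (fun p x => w p i x - σ i ^ (-(q : ℝ)) * ∑ b, A p b * x b) p r x
      = ∑ m, a m i x * a m i x * (η m p * η m r) := by
    intro p r i x
    have hsym : ∀ p r, gramError T (fun j => v j i) (fun p => w p i) p r x
        = gramError T (fun j => v j i) (fun p => w p i) r p x := by
      intro p r
      simp only [gramError, hT p r, mul_comm (pd p _ x), add_comm (pd r _ x)]
    have h1 := hηL (fun p r => gramError T (fun j => v j i) (fun p => w p i) p r x) hsym p r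
    have h2 : gramError T (fun j => v j i)
        (fun p x => w p i x - σ i ^ (-(q : ℝ)) * ∑ b, A p b * x b) p r x
        = gramError T (fun j => v j i) (fun p => w p i) p r x + A p r * σ i ^ (-(q : ℝ)) := by
      simp only [gramError, hws, hA r p]
      ring
    rw [h2, h1, Finset.sum_mul, ← Finset.sum_add_distrib]
    refine Finset.sum_congr rfl fun m _ => ?_
    rw [haa]
    ring
  obtain ⟨v', w', hb, hE⟩ := exists_corrugate_sum hσ hk hc hkc hF h' ha η hG' le_rfl
  refine ⟨v', w', by rwa [add_mul, one_mul], fun p r => ?_⟩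
  convert hE p r using 3 with i x
  rw [Finset.filter_false_of_mem fun m _ => not_le.2 m.2, Finset.sum_empty, sub_zero]

/-- After `N` stages the mismatch is of order `σ ^ (-N)`. -/
theorem exists_gramError_le (hσ : ∀ i, 1 ≤ σ i) (hk : 1 ≤ k) (hc : 0 ≤ c) (hkc : 1 ≤ k * c)
    (hT : ∀ p r, T p r = T r p) (hTs : ∀ p r, IsSymbol σ 0 0 (fun _ => T p r)) (N : ℕ) :
    ∃ (v : Fin k → ι → (Fin d → ℝ) → ℝ) (w : Fin d → ι → (Fin d → ℝ) → ℝ),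
      CorrugationBounds σ c (N * (d * (d + 1) / 2))
        (N * ((d * (d + 1) / 2 : ℕ) : ℝ) * c + N / 2) v w ∧
      ∀ p r, IsSymbol σ (N * ((d * (d + 1) / 2 : ℕ) : ℝ) * c + N / 2) (-(N : ℝ))
        (fun i x => gramError T (fun j => v j i) (fun p => w p i) p r x) := by
  induction N with
  | zero =>
    refine ⟨_, _, by simpa using CorrugationBounds.zero hσ, fun p r => ?_⟩
    have h0 : ∀ r (x : Fin d → ℝ), pd r (fun _ : Fin d → ℝ => (0 : ℝ)) x = 0 := fun r x =>
      pd_const 0 r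
    simpa [gramError, h0] using hTs p r
  | succ N ih =>
    obtain ⟨v, w, h, hG⟩ := ih
    obtain ⟨v', w', h', hG'⟩ := exists_stage hσ hk hc hkc hT rfl h hG
    have hF : N * ((d * (d + 1) / 2 : ℕ) : ℝ) * c + N / 2 + ((d * (d + 1) / 2 : ℕ) : ℝ) * c + 1 / 2
        = (N + 1 : ℕ) * ((d * (d + 1) / 2 : ℕ) : ℝ) * c + (N + 1 : ℕ) / 2 := by
      push_cast
      ring
    rw [hF] at h' hG'
    exact ⟨v', w', h', by simpa using hG'⟩

theorem exists_displacement (hσ : ∀ i, 1 ≤ σ i) (hk : 1 ≤ k) (hc : 0 ≤ c) (hkc : 1 ≤ k * c)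
    (hT : ∀ p r, T p r = T r p) (hTs : ∀ p r, IsSymbol σ 0 0 (fun _ => T p r)) (N : ℕ) :
    ∃ (v : Fin k → ι → (Fin d → ℝ) → ℝ) (w : Fin d → ι → (Fin d → ℝ) → ℝ) (C : ℝ), 0 ≤ C ∧
      (∀ j i, ContDiff ℝ (⊤ : ℕ∞) (v j i)) ∧ (∀ p i, ContDiff ℝ (⊤ : ℕ∞) (w p i)) ∧
      ∀ i x,
        (∀ p r, |gramError T (fun j => v j i) (fun p => w p i) p r x| ≤ C * σ i ^ (-(N : ℝ))) ∧
        (∀ j r, |pd r (v j i) x| ≤ C) ∧ (∀ p r, |pd r (w p i) x| ≤ C) ∧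
        (∀ j p r, |pd r (pd p (v j i)) x|
          ≤ C * σ i ^ ((N * (d * (d + 1) / 2 : ℕ) + 2 * k) * c + 1 / 2)) ∧
        (∀ q p r, |pd r (pd p (w q i)) x|
          ≤ C * σ i ^ ((N * (d * (d + 1) / 2 : ℕ) + 2 * k) * c + 1 / 2)) := by
  obtain ⟨v, w, h, hG⟩ := exists_gramError_le hσ hk hc hkc hT hTs N
  have hv2 : ∀ j p r, IsSymbol σ (N * ((d * (d + 1) / 2 : ℕ) : ℝ) * c + N / 2)
      ((N * (d * (d + 1) / 2 : ℕ) + 2 * k) * c + 1 / 2) (fun i => pd r (pd p (v j i))) := by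
    intro j p r
    set n := N * (d * (d + 1) / 2) with hn
    let m := (n / k + 1) * k + j.val
    have hm : n ≤ m := by
      have := Nat.lt_mul_div_succ n hk
      rw [mul_comm] at this
      omega
    have hm' : m ≤ n + 2 * k := by
      have := Nat.div_mul_le_self n k
      have := j.2
      simp only [m, Nat.succ_mul]
      omega
    have hmc : (m : ℝ) ≤ N * (d * (d + 1) / 2 : ℕ) + 2 * k := by
      rw [hn] at hm'
      exact_mod_cast hm'
    refine (h.pd_pd_v m hm j ?_ p r).mono hσ ?_ le_rfl
    · exact (Nat.mul_add_mod_of_lt j.2).symm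
    · have := mul_le_mul_of_nonneg_right hmc hc
      linarith
  have hw2 : ∀ q p r, IsSymbol σ (N * ((d * (d + 1) / 2 : ℕ) : ℝ) * c + N / 2)
      ((N * (d * (d + 1) / 2 : ℕ) + 2 * k) * c + 1 / 2) (fun i => pd r (pd p (w q i))) := by
    intro q p r
    refine (h.pd_pd_w q p r).mono hσ ?_ le_rfl
    have : 0 ≤ (k : ℝ) * c := by positivity
    push_cast
    linarith
  choose C₁ h₁ hb₁ using fun p r => (hG p r).exists_bound
  choose C₂ h₂ hb₂ using fun j r => (h.pd_v j r).exists_bound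
  choose C₃ h₃ hb₃ using fun p r => (h.pd_w p r).exists_bound
  choose C₄ h₄ hb₄ using fun j p r => (hv2 j p r).exists_bound
  choose C₅ h₅ hb₅ using fun q p r => (hw2 q p r).exists_bound
  simp only [Real.rpow_zero, mul_one] at hb₂ hb₃
  have hev : ∀ᶠ C in Filter.atTop, 0 ≤ C ∧ (∀ p r, C₁ p r ≤ C) ∧ (∀ j r, C₂ j r ≤ C) ∧
      (∀ p r, C₃ p r ≤ C) ∧ (∀ j p r, C₄ j p r ≤ C) ∧ (∀ q p r, C₅ q p r ≤ C) := by
    simp only [Filter.eventually_and, Filter.eventually_all]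
    exact ⟨Filter.eventually_ge_atTop 0, fun _ _ => Filter.eventually_ge_atTop _,
      fun _ _ => Filter.eventually_ge_atTop _, fun _ _ => Filter.eventually_ge_atTop _,
      fun _ _ _ => Filter.eventually_ge_atTop _, fun _ _ _ => Filter.eventually_ge_atTop _⟩
  obtain ⟨C, hC, hC₁, hC₂, hC₃, hC₄, hC₅⟩ := hev.exists
  have hpos : ∀ i (m : ℝ), 0 ≤ σ i ^ m := fun i m => Real.rpow_nonneg (zero_le_one.trans (hσ i)) m
  exact ⟨v, w, C, hC, h.smooth_v, h.smooth_w, fun i x =>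
    ⟨fun p r => (hb₁ p r i x).trans (mul_le_mul_of_nonneg_right (hC₁ p r) (hpos i _)),
      fun j r => (hb₂ j r i x).trans (hC₂ j r), fun p r => (hb₃ p r i x).trans (hC₃ p r),
      fun j p r => (hb₄ j p r i x).trans (mul_le_mul_of_nonneg_right (hC₄ j p r) (hpos i _)),
      fun q p r => (hb₅ q p r i x).trans (mul_le_mul_of_nonneg_right (hC₅ q p r) (hpos i _))⟩⟩

end Stage

/-- Families of smooth functions that are bounded on `ω`, with first derivatives of size `τ`. -/
structure IsTame {d : ℕ} {ι : Type*} (ω : Set (Fin d → ℝ)) (τ : ι → ℝ)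
    (f : ι → (Fin d → ℝ) → ℝ) : Prop where
  smooth : ∀ i, ContDiff ℝ (⊤ : ℕ∞) (f i)
  bound : ∃ C, 0 ≤ C ∧ ∀ i, ∀ x ∈ ω, |f i x| ≤ C
  pd_bound : ∀ r, ∃ C, 0 ≤ C ∧ ∀ i, ∀ x ∈ ω, |pd r (f i) x| ≤ C * τ i

namespace IsTame

variable {d : ℕ} {ι : Type*} {ω : Set (Fin d → ℝ)} {τ : ι → ℝ} {f g : ι → (Fin d → ℝ) → ℝ}

theorem add (hf : IsTame ω τ f) (hg : IsTame ω τ g) : IsTame ω τ (fun i x => f i x + g i x) := by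
  refine ⟨fun i => (hf.smooth i).add (hg.smooth i), ?_, fun r => ?_⟩
  · obtain ⟨C, hC, h⟩ := hf.bound
    obtain ⟨C', hC', h'⟩ := hg.bound
    exact ⟨C + C', by positivity, fun i x hx =>
      (abs_add_le _ _).trans (add_le_add (h i x hx) (h' i x hx))⟩
  · obtain ⟨C, hC, h⟩ := hf.pd_bound r
    obtain ⟨C', hC', h'⟩ := hg.pd_bound r
    refine ⟨C + C', by positivity, fun i x hx => ?_⟩
    rw [pd_add ((hf.smooth i).diffAt x) ((hg.smooth i).diffAt x), add_mul]
    exact (abs_add_le _ _).trans (add_le_add (h i x hx) (h' i x hx))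

theorem mul (hf : IsTame ω τ f) (hg : IsTame ω τ g) : IsTame ω τ (fun i x => f i x * g i x) := by
  obtain ⟨C, hC, h⟩ := hf.bound
  obtain ⟨C', hC', h'⟩ := hg.bound
  refine ⟨fun i => (hf.smooth i).mul (hg.smooth i), ⟨C * C', by positivity, fun i x hx => ?_⟩,
    fun r => ?_⟩
  · rw [abs_mul]
    exact mul_le_mul (h i x hx) (h' i x hx) (abs_nonneg _) hC
  · obtain ⟨K, hK, hf'⟩ := hf.pd_bound r
    obtain ⟨K', hK', hg'⟩ := hg.pd_bound r
    refine ⟨K * C' + C * K', by positivity, fun i x hx => ?_⟩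
    rw [pd_mul ((hf.smooth i).diffAt x) ((hg.smooth i).diffAt x)]
    refine (abs_add_le _ _).trans ?_
    rw [abs_mul, abs_mul]
    have h1 := mul_le_mul (hf' i x hx) (h' i x hx) (abs_nonneg _)
      ((abs_nonneg _).trans (hf' i x hx))
    have h2 := mul_le_mul (h i x hx) (hg' i x hx) (abs_nonneg _) hC
    linarith

theorem of_bounded {c : ι → ℝ} {C : ℝ} (hC : 0 ≤ C) (hc : ∀ i, |c i| ≤ C) :
    IsTame ω τ (fun i _ => c i) :=
  ⟨fun _ => contDiff_const, ⟨C, hC, fun i _ _ => hc i⟩, fun r => ⟨0, le_rfl, fun i x _ => by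
    rw [pd_const, abs_zero, zero_mul]⟩⟩

theorem const (c : ℝ) : IsTame ω τ (fun _ _ => c) :=
  of_bounded (abs_nonneg c) fun _ => le_rfl

theorem sub (hf : IsTame ω τ f) (hg : IsTame ω τ g) :
    IsTame ω τ (fun i x => f i x - g i x) := by
  simpa [sub_eq_add_neg] using hf.add ((const (-1)).mul hg)

theorem sum {α : Type*} (s : Finset α) {F : α → ι → (Fin d → ℝ) → ℝ}
    (hF : ∀ a, IsTame ω τ (F a)) : IsTame ω τ (fun i x => ∑ a ∈ s, F a i x) := by
  classical
  induction s using Finset.induction_on with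
  | empty => simpa using const 0
  | insert a s ha ih =>
    simp only [Finset.sum_insert ha]
    exact (hF a).add ih

theorem of_smooth (hτ : ∀ i, 1 ≤ τ i) (hω : Bornology.IsBounded ω) {F : (Fin d → ℝ) → ℝ}
    (hF : ContDiff ℝ (⊤ : ℕ∞) F) : IsTame ω τ (fun _ => F) := by
  have key : ∀ F : (Fin d → ℝ) → ℝ, Continuous F → ∃ C, 0 ≤ C ∧ ∀ x ∈ ω, |F x| ≤ C := by
    intro F hF
    obtain ⟨C, hC⟩ := hω.isCompact_closure.exists_bound_of_continuousOn hF.continuousOn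
    exact ⟨|C|, abs_nonneg C, fun x hx => (hC x (subset_closure hx)).trans (le_abs_self C)⟩
  refine ⟨fun _ => hF, ?_, fun r => ?_⟩
  · obtain ⟨C, hC, h⟩ := key F hF.continuous
    exact ⟨C, hC, fun _ => h⟩
  · obtain ⟨C, hC, h⟩ := key _ (contDiff_pd hF r).continuous
    exact ⟨C, hC, fun i x hx => (h x hx).trans (le_mul_of_one_le_right hC (hτ i))⟩

end IsTame

section Film

variable {d k : ℕ}

theorem contDiff_xpart : ContDiff ℝ (⊤ : ℕ∞) (xpart : (Fin (d + k) → ℝ) → Fin d → ℝ) :=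
  contDiff_pi.2 fun i => contDiff_apply ℝ ℝ (Fin.castAdd k i)

theorem contDiff_zpart (l : Fin k) :
    ContDiff ℝ (⊤ : ℕ∞) (fun P : Fin (d + k) → ℝ => zpart P l) :=
  contDiff_apply ℝ ℝ (Fin.natAdd d l)

theorem fderiv_comp_xpart {f : (Fin d → ℝ) → ℝ} (P : Fin (d + k) → ℝ)
    (hf : DifferentiableAt ℝ f (xpart P)) (V : Fin (d + k) → ℝ) :
    fderiv ℝ (fun P : Fin (d + k) → ℝ => f (xpart P)) P V = fderiv ℝ f (xpart P) (xpart V) := by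
  have h : HasFDerivAt (xpart : (Fin (d + k) → ℝ) → Fin d → ℝ)
      (ContinuousLinearMap.pi fun i : Fin d =>
        ContinuousLinearMap.proj (R := ℝ) (φ := fun _ : Fin (d + k) => ℝ) (Fin.castAdd k i)) P :=
    hasFDerivAt_pi.2 fun i => hasFDerivAt_apply (Fin.castAdd k i) P
  change fderiv ℝ (f ∘ xpart) P V = _
  rw [(hf.hasFDerivAt.comp P h).fderiv]
  rfl

theorem pd_castAdd_comp_xpart {f : (Fin d → ℝ) → ℝ} {P : Fin (d + k) → ℝ}
    (hf : DifferentiableAt ℝ f (xpart P)) (r : Fin d) :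
    pd (Fin.castAdd k r) (fun P : Fin (d + k) → ℝ => f (xpart P)) P = pd r f (xpart P) := by
  rw [pd, fderiv_comp_xpart P hf, pd]
  congr 1
  funext i
  simp [xpart, Pi.single_apply]

theorem pd_natAdd_comp_xpart {f : (Fin d → ℝ) → ℝ} {P : Fin (d + k) → ℝ}
    (hf : DifferentiableAt ℝ f (xpart P)) (l : Fin k) :
    pd (Fin.natAdd d l) (fun P : Fin (d + k) → ℝ => f (xpart P)) P = 0 := by
  rw [pd, fderiv_comp_xpart P hf]
  have : xpart (Pi.single (Fin.natAdd d l) (1 : ℝ)) = (0 : Fin d → ℝ) := by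
    funext i
    simp [xpart, Pi.single_apply, Fin.ext_iff]
    omega
  rw [this, map_zero]

/-- The deformation of the film that is affine in the normal variable, with mid-surface `Y` and
directors `N`. -/
def filmMap (Y : Fin (d + k) → (Fin d → ℝ) → ℝ) (N : Fin (d + k) → Fin k → (Fin d → ℝ) → ℝ)
    (P : Fin (d + k) → ℝ) (I : Fin (d + k)) : ℝ :=
  Y I (xpart P) + ∑ l, zpart P l * N I l (xpart P)

variable {Y : Fin (d + k) → (Fin d → ℝ) → ℝ} {N : Fin (d + k) → Fin k → (Fin d → ℝ) → ℝ}

theorem contDiff_filmMap (hY : ∀ I, ContDiff ℝ (⊤ : ℕ∞) (Y I))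
    (hN : ∀ I l, ContDiff ℝ (⊤ : ℕ∞) (N I l)) : ContDiff ℝ (⊤ : ℕ∞) (filmMap Y N) :=
  contDiff_pi.2 fun I => ((hY I).comp contDiff_xpart).add
    (ContDiff.sum fun l _ => (contDiff_zpart l).mul ((hN I l).comp contDiff_xpart))

theorem matJac_filmMap (hY : ∀ I, ContDiff ℝ (⊤ : ℕ∞) (Y I))
    (hN : ∀ I l, ContDiff ℝ (⊤ : ℕ∞) (N I l)) (P : Fin (d + k) → ℝ) (I K : Fin (d + k)) :
    matJac (filmMap Y N) P I K
      = Fin.addCases (fun r => pd r (Y I) (xpart P)) (fun l => N I l (xpart P)) K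
        + Fin.addCases (fun r => ∑ l, zpart P l * pd r (N I l) (xpart P)) (fun _ => 0) K := by
  have h1 : DifferentiableAt ℝ (fun P : Fin (d + k) → ℝ => Y I (xpart P)) P :=
    ((hY I).comp contDiff_xpart).diffAt P
  have h2 : ∀ l, DifferentiableAt ℝ (fun P : Fin (d + k) → ℝ => N I l (xpart P)) P := fun l =>
    ((hN I l).comp contDiff_xpart).diffAt P
  have h3 : ∀ l : Fin k, DifferentiableAt ℝ (fun P : Fin (d + k) → ℝ => zpart P l) P := fun l =>
    (contDiff_zpart l).diffAt P
  simp only [matJac, filmMap]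
  rw [pd_add h1 (DifferentiableAt.fun_sum fun l _ => (h3 l).fun_mul (h2 l)),
    pd_sum _ fun l _ => (h3 l).fun_mul (h2 l)]
  simp only [fun l => pd_mul (h3 l) (h2 l) K]
  have h4 : ∀ l, pd K (fun P : Fin (d + k) → ℝ => zpart P l) P
      = if Fin.natAdd d l = K then 1 else 0 := fun l => pd_coord (Fin.natAdd d l) K
  simp only [h4]
  refine Fin.addCases (fun r => ?_) (fun l => ?_) K
  · simp only [pd_castAdd_comp_xpart ((hY I).diffAt _),
      pd_castAdd_comp_xpart ((hN I _).diffAt _), Fin.addCases_left]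
    congr 1
    refine Finset.sum_congr rfl fun l _ => ?_
    have : Fin.natAdd d l ≠ Fin.castAdd k r := by
      simp [Fin.ext_iff]
      omega
    rw [if_neg this, zero_mul, zero_add]
  · simp only [pd_natAdd_comp_xpart ((hY I).diffAt _),
      pd_natAdd_comp_xpart ((hN I _).diffAt _), Fin.addCases_right, mul_zero, add_zero, zero_add,
      Fin.natAdd_inj]
    simp

end Film

section Algebra

variable {d k : ℕ} (ε : ℝ)

theorem gram_tangential (Dw : Fin d → Fin d → ℝ) (Dv : Fin k → Fin d → ℝ) (r r' : Fin d) :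
    ∑ p, ((if p = r then 1 else 0) + ε ^ 2 * Dw p r) * ((if p = r' then 1 else 0) + ε ^ 2 * Dw p r')
        + ∑ j, (ε * Dv j r) * (ε * Dv j r')
      = (if r = r' then 1 else 0)
        + ε ^ 2 * (∑ j, Dv j r * Dv j r' + (Dw r r' + Dw r' r))
        + ε ^ 4 * ∑ p, Dw p r * Dw p r' := by
  have h1 : ∀ p, ((if p = r then 1 else 0) + ε ^ 2 * Dw p r)
        * ((if p = r' then 1 else 0) + ε ^ 2 * Dw p r')
      = (if p = r then (if p = r' then 1 else 0) else 0)
        + (if p = r then ε ^ 2 * Dw p r' else 0) + (if p = r' then ε ^ 2 * Dw p r else 0)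
        + ε ^ 4 * (Dw p r * Dw p r') := by
    intro p
    split_ifs <;> ring
  have h2 : ∀ j, (ε * Dv j r) * (ε * Dv j r') = ε ^ 2 * (Dv j r * Dv j r') := fun j => by ring
  simp only [h1, h2, Finset.sum_add_distrib, Finset.sum_ite_eq', Finset.mem_univ, if_true,
    ← Finset.mul_sum]
  ring

theorem gram_mixed (Dw : Fin d → Fin d → ℝ) (Dv : Fin k → Fin d → ℝ) (a b : Fin d → Fin k → ℝ)
    (c e : Fin k → Fin k → ℝ)
    (hb : ∀ p l, b p l = ∑ q, Dw q p * Dv l q - ∑ j, Dv j p * c j l) (r : Fin d) (l : Fin k) :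
    ∑ p, ((if p = r then 1 else 0) + ε ^ 2 * Dw p r)
          * (-ε * Dv l p + ε ^ 2 * a p l + ε ^ 3 * b p l)
        + ∑ j, (ε * Dv j r) * ((if j = l then 1 else 0) + ε ^ 2 * c j l + ε ^ 3 * e j l)
      = ε ^ 2 * a r l
        + ε ^ 4 * (∑ p, Dw p r * (a p l + ε * b p l) + ∑ j, Dv j r * e j l) := by
  have h1 : ∀ p, ((if p = r then 1 else 0) + ε ^ 2 * Dw p r)
        * (-ε * Dv l p + ε ^ 2 * a p l + ε ^ 3 * b p l)
      = (if p = r then -ε * Dv l p + ε ^ 2 * a p l + ε ^ 3 * b p l else 0)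
        - ε ^ 3 * (Dw p r * Dv l p) + ε ^ 4 * (Dw p r * (a p l + ε * b p l)) := by
    intro p
    split_ifs <;> ring
  have h2 : ∀ j, (ε * Dv j r) * ((if j = l then 1 else 0) + ε ^ 2 * c j l + ε ^ 3 * e j l)
      = (if j = l then ε * Dv j r else 0) + ε ^ 3 * (Dv j r * c j l)
        + ε ^ 4 * (Dv j r * e j l) := by
    intro j
    split_ifs <;> ring
  simp only [h1, h2, Finset.sum_add_distrib, Finset.sum_sub_distrib, Finset.sum_ite_eq',
    Finset.mem_univ, if_true, ← Finset.mul_sum]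
  linear_combination ε ^ 3 * hb r l

theorem gram_normal (Dv : Fin k → Fin d → ℝ) (a b : Fin d → Fin k → ℝ)
    (c e S : Fin k → Fin k → ℝ) (hS : ∀ l m, S l m = S m l)
    (hc : ∀ j l, c j l = S j l - 1 / 2 * ∑ p, Dv j p * Dv l p)
    (he : ∀ j l, e j l = ∑ p, Dv j p * a p l) (l m : Fin k) :
    ∑ p, (-ε * Dv l p + ε ^ 2 * a p l + ε ^ 3 * b p l)
          * (-ε * Dv m p + ε ^ 2 * a p m + ε ^ 3 * b p m)
        + ∑ j, ((if j = l then 1 else 0) + ε ^ 2 * c j l + ε ^ 3 * e j l)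
          * ((if j = m then 1 else 0) + ε ^ 2 * c j m + ε ^ 3 * e j m)
      = (if l = m then 1 else 0) + 2 * ε ^ 2 * S l m
        + ε ^ 4 * (∑ p, (a p l + ε * b p l) * (a p m + ε * b p m)
          - ∑ p, (Dv l p * b p m + Dv m p * b p l)
          + ∑ j, (c j l + ε * e j l) * (c j m + ε * e j m)) := by
  have h1 : ∀ p, (-ε * Dv l p + ε ^ 2 * a p l + ε ^ 3 * b p l)
        * (-ε * Dv m p + ε ^ 2 * a p m + ε ^ 3 * b p m)
      = ε ^ 2 * (Dv l p * Dv m p) - ε ^ 3 * (Dv l p * a p m) - ε ^ 3 * (Dv m p * a p l)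
        + ε ^ 4 * ((a p l + ε * b p l) * (a p m + ε * b p m))
        - ε ^ 4 * (Dv l p * b p m + Dv m p * b p l) := by
    intro p
    ring
  have h2 : ∀ j, ((if j = l then 1 else 0) + ε ^ 2 * c j l + ε ^ 3 * e j l)
        * ((if j = m then 1 else 0) + ε ^ 2 * c j m + ε ^ 3 * e j m)
      = (if j = l then (if j = m then 1 else 0) else 0)
        + (if j = l then ε ^ 2 * c j m + ε ^ 3 * e j m else 0)
        + (if j = m then ε ^ 2 * c j l + ε ^ 3 * e j l else 0)
        + ε ^ 4 * ((c j l + ε * e j l) * (c j m + ε * e j m)) := by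
    intro j
    split_ifs <;> ring
  have h3 : ∑ p, Dv m p * Dv l p = ∑ p, Dv l p * Dv m p :=
    Finset.sum_congr rfl fun p _ => mul_comm _ _
  simp only [h1, h2, Finset.sum_add_distrib, Finset.sum_sub_distrib, Finset.sum_ite_eq',
    Finset.mem_univ, if_true, ← Finset.mul_sum]
  have c1 := hc l m
  have c2 := hc m l
  rw [h3, hS m l] at c2
  linear_combination ε ^ 2 * c1 + ε ^ 2 * c2 + ε ^ 3 * he l m + ε ^ 3 * he m l

end Algebra

theorem exists_common_bound {α : Type*} [Finite α] {p : α → ℝ → Prop}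
    (hp : ∀ a C C', C ≤ C' → p a C → p a C') (h : ∀ a, ∃ C, 0 ≤ C ∧ p a C) :
    ∃ C, 0 ≤ C ∧ ∀ a, p a C := by
  have : ∀ᶠ C in Filter.atTop, 0 ≤ C ∧ ∀ a, p a C := by
    refine (Filter.eventually_ge_atTop 0).and (Filter.eventually_all.2 fun a => ?_)
    obtain ⟨C, -, hC⟩ := h a
    exact (Filter.eventually_ge_atTop C).mono fun C' hC' => hp a C C' hC' hC
  exact this.exists

theorem abs_sum_perturbed_mul_sub_le {n : ℕ} {X X' z z' : Fin n → ℝ} {B Z : ℝ} (hB : 0 ≤ B)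
    (hX : ∀ i, |X i| ≤ B) (hX' : ∀ i, |X' i| ≤ B) (hz : ∀ i, |z i| ≤ Z) (hz' : ∀ i, |z' i| ≤ Z) :
    |∑ i, (X i + z i) * (X' i + z' i) - ∑ i, X i * X' i| ≤ n * (2 * B * Z + Z * Z) := by
  rw [← Finset.sum_sub_distrib]
  refine (Finset.abs_sum_le_sum_abs _ _).trans ?_
  have : ∀ i ∈ Finset.univ, |(X i + z i) * (X' i + z' i) - X i * X' i| ≤ 2 * B * Z + Z * Z := by
    intro i _
    have hZ : 0 ≤ Z := (abs_nonneg _).trans (hz i)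
    have h1 := mul_le_mul (hX i) (hz' i) (abs_nonneg _) hB
    have h2 := mul_le_mul (hz i) (hX' i) (abs_nonneg _) hZ
    have h3 := mul_le_mul (hz i) (hz' i) (abs_nonneg _) hZ
    rw [← abs_mul] at h1 h2 h3
    calc |(X i + z i) * (X' i + z' i) - X i * X' i|
        = |X i * z' i + z i * X' i + z i * z' i| := by ring_nf
      _ ≤ |X i * z' i| + |z i * X' i| + |z i * z' i| := abs_add_three _ _ _
      _ ≤ 2 * B * Z + Z * Z := by linarith
  refine (Finset.sum_le_sum this).trans_eq ?_
  rw [Finset.sum_const, Finset.card_univ, Fintype.card_fin, nsmul_eq_mul]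

/-- The Kirchhoff-Love type extension of a mid-surface displacement to the film. -/
theorem exists_film_deformation {d k : ℕ} {ι : Type*} {ω : Set (Fin d → ℝ)}
    (hω : Bornology.IsBounded ω) {τ : ι → ℝ} (hτ : ∀ i, 1 ≤ τ i)
    {S : (Fin d → ℝ) → Fin (d + k) → Fin (d + k) → ℝ} (hS : ContDiff ℝ (⊤ : ℕ∞) S)
    (hSsym : ∀ x i j, S x i j = S x j i)
    {v : Fin k → ι → (Fin d → ℝ) → ℝ} {w : Fin d → ι → (Fin d → ℝ) → ℝ}
    (hv : ∀ j i, ContDiff ℝ (⊤ : ℕ∞) (v j i)) (hw : ∀ p i, ContDiff ℝ (⊤ : ℕ∞) (w p i))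
    (hDv : ∀ j r, IsTame ω τ (fun i => pd r (v j i)))
    (hDw : ∀ p r, IsTame ω τ (fun i => pd r (w p i)))
    {h ε E ρ : ι → ℝ} (hh : ∀ i, 0 < h i) (hε0 : ∀ i, 0 < ε i) (hε1 : ∀ i, ε i ≤ 1)
    {C₀ : ℝ} (hC₀ : 0 ≤ C₀) (hG : ∀ i, ∀ x ∈ ω, ∀ p r,
      |gramError (fun p r x => S x (Fin.castAdd k p) (Fin.castAdd k r)) (fun j => v j i)
        (fun p => w p i) p r x| ≤ C₀ * ρ i)
    (hE1 : ∀ i, ε i ^ 2 * ρ i ≤ E i) (hE2 : ∀ i, ε i ^ 4 ≤ E i)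
    (hE3 : ∀ i, h i * ε i * τ i ≤ E i) (hE4 : ∀ i, E i ≤ ε i) :
    ∃ A, ∀ i, ∃ u : (Fin (d + k) → ℝ) → Fin (d + k) → ℝ, ContDiff ℝ (⊤ : ℕ∞) u ∧
      ∀ P ∈ thinFilm ω (h i) (k := k), (∀ I K, |matJac u P I K - matId I K| ≤ A * ε i) ∧
        ∀ K L, |∑ I, matJac u P I K * matJac u P I L
          - (matId K L + 2 * ε i ^ 2 * S (xpart P) K L)| ≤ A * E i := by
  have hE0 : ∀ i, 0 ≤ E i := fun i => (by have := hε0 i; positivity : 0 ≤ ε i ^ 4).trans (hE2 i)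
  have hεt : ∀ n : ℕ, IsTame ω τ (fun i _ => ε i ^ n) := fun n =>
    .of_bounded zero_le_one fun i => by
      rw [abs_of_nonneg (by have := hε0 i; positivity)]
      exact pow_le_one₀ (hε0 i).le (hε1 i)
  have hεt1 : IsTame ω τ (fun i _ => ε i) := by simpa using hεt 1
  have hSt : ∀ K L, IsTame ω τ (fun _ x => S x K L) := fun K L =>
    .of_smooth hτ hω (contDiff_pi.1 (contDiff_pi.1 hS K) L)
  let a : Fin d → Fin k → ι → (Fin d → ℝ) → ℝ := fun p l _ x =>
    2 * S x (Fin.castAdd k p) (Fin.natAdd d l)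
  let c : Fin k → Fin k → ι → (Fin d → ℝ) → ℝ := fun j l i x =>
    S x (Fin.natAdd d j) (Fin.natAdd d l) - 1 / 2 * ∑ p, pd p (v j i) x * pd p (v l i) x
  let b : Fin d → Fin k → ι → (Fin d → ℝ) → ℝ := fun p l i x =>
    ∑ q, pd p (w q i) x * pd q (v l i) x - ∑ j, pd p (v j i) x * c j l i x
  let e : Fin k → Fin k → ι → (Fin d → ℝ) → ℝ := fun j l i x => ∑ p, pd p (v j i) x * a p l i x
  have ha : ∀ p l, IsTame ω τ (a p l) := fun p l => (IsTame.const 2).mul (hSt _ _)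
  have hc : ∀ j l, IsTame ω τ (c j l) := fun j l =>
    (hSt _ _).sub ((IsTame.const _).mul (.sum _ fun p => (hDv j p).mul (hDv l p)))
  have hb : ∀ p l, IsTame ω τ (b p l) := fun p l =>
    (IsTame.sum _ fun q => (hDw q p).mul (hDv l q)).sub
      (IsTame.sum _ fun j => (hDv j p).mul (hc j l))
  have he : ∀ j l, IsTame ω τ (e j l) := fun j l => IsTame.sum _ fun p => (hDv j p).mul (ha p l)
  let Y : ι → Fin (d + k) → (Fin d → ℝ) → ℝ := fun i I x =>
    Fin.addCases (fun p => x p + ε i ^ 2 * w p i x) (fun j => ε i * v j i x) I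
  let B : Fin (d + k) → Fin (d + k) → ι → (Fin d → ℝ) → ℝ := fun I K i x =>
    Fin.addCases
      (fun r => Fin.addCases (fun p => ε i * pd r (w p i) x) (fun j => pd r (v j i) x) I)
      (fun l => Fin.addCases
        (fun p => -1 * pd p (v l i) x + ε i * a p l i x + ε i ^ 2 * b p l i x)
        (fun j => ε i * c j l i x + ε i ^ 2 * e j l i x) I) K
  let N : ι → Fin (d + k) → Fin k → (Fin d → ℝ) → ℝ := fun i I l x =>
    matId I (Fin.natAdd d l) + ε i * B I (Fin.natAdd d l) i x
  have hB : ∀ I K, IsTame ω τ (B I K) := by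
    intro I K
    refine Fin.addCases (fun r => ?_) (fun l => ?_) K <;>
      refine Fin.addCases (fun p => ?_) (fun j => ?_) I <;>
      simp only [B, Fin.addCases_left, Fin.addCases_right]
    · exact hεt1.mul (hDw p r)
    · exact hDv j r
    · exact (((IsTame.const (-1)).mul (hDv l p)).add (hεt1.mul (ha p l))).add
        ((hεt 2).mul (hb p l))
    · exact (hεt1.mul (hc j l)).add ((hεt 2).mul (he j l))
  have hY : ∀ i I, ContDiff ℝ (⊤ : ℕ∞) (Y i I) := by
    intro i I
    refine Fin.addCases (fun p => ?_) (fun j => ?_) I <;>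
      simp only [Y, Fin.addCases_left, Fin.addCases_right]
    · exact (contDiff_apply ℝ ℝ p).add (contDiff_const.mul (hw p i))
    · exact contDiff_const.mul (hv j i)
  have hN : ∀ i I l, ContDiff ℝ (⊤ : ℕ∞) (N i I l) := fun i I l =>
    contDiff_const.add (contDiff_const.mul ((hB I _).smooth i))
  have hpdY : ∀ i I r x, pd r (Y i I) x
      = matId I (Fin.castAdd k r) + ε i * B I (Fin.castAdd k r) i x := by
    intro i I r x
    refine Fin.addCases (fun p => ?_) (fun j => ?_) I <;>
      simp only [Y, B, Fin.addCases_left, Fin.addCases_right, matId]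
    · rw [pd_add (by fun_prop) (((hw p i).diffAt x).const_mul _),
        pd_const_mul _ ((hw p i).diffAt x), pd_coord]
      simp only [Fin.castAdd_inj]
      ring
    · rw [pd_const_mul _ ((hv j i).diffAt x), if_neg, zero_add]
      simp [Fin.ext_iff]
      omega
  have hpdN : ∀ i I l r x, pd r (N i I l) x = ε i * pd r (B I (Fin.natAdd d l) i) x := by
    intro i I l r x
    have hd := ((hB I (Fin.natAdd d l)).smooth i).diffAt x
    simp only [N]
    rw [pd_add (by fun_prop) (hd.const_mul _), pd_const, pd_const_mul _ hd, zero_add]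
  have hfour : ∀ f : ι → (Fin d → ℝ) → ℝ, IsTame ω τ f →
      ∃ C, 0 ≤ C ∧ ∀ i, ∀ x ∈ ω, |ε i ^ 4 * f i x| ≤ C * E i := by
    intro f hf
    obtain ⟨C, hC, hb⟩ := hf.bound
    refine ⟨C, hC, fun i x hx => ?_⟩
    have h4 : 0 ≤ ε i ^ 4 := by have := hε0 i; positivity
    rw [abs_mul, abs_of_nonneg h4, mul_comm C]
    exact mul_le_mul (hE2 i) (hb i x hx) (abs_nonneg _) (hE0 i)
  have hgram : ∀ K L, ∃ C, 0 ≤ C ∧ ∀ i, ∀ x ∈ ω,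
      |∑ I, (matId I K + ε i * B I K i x) * (matId I L + ε i * B I L i x)
        - (matId K L + 2 * ε i ^ 2 * S x K L)| ≤ C * E i := by
    have hcn : ∀ (p : Fin d) (l : Fin k), Fin.castAdd k p ≠ Fin.natAdd d l := by
      intro p l
      simp [Fin.ext_iff]
      omega
    have hmix : ∀ r l, ∃ C, 0 ≤ C ∧ ∀ i, ∀ x ∈ ω,
        |∑ I, (matId I (Fin.castAdd k r) + ε i * B I (Fin.castAdd k r) i x)
            * (matId I (Fin.natAdd d l) + ε i * B I (Fin.natAdd d l) i x)
          - (matId (Fin.castAdd k r) (Fin.natAdd d l)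
            + 2 * ε i ^ 2 * S x (Fin.castAdd k r) (Fin.natAdd d l))| ≤ C * E i := by
      intro r l
      obtain ⟨C, hC, hCb⟩ := hfour _ ((IsTame.sum Finset.univ fun p =>
        (hDw p r).mul ((ha p l).add (hεt1.mul (hb p l)))).add
          (IsTame.sum Finset.univ fun j => (hDv j r).mul (he j l)))
      refine ⟨C, hC, fun i x hx => ?_⟩
      refine (le_of_eq ?_).trans (hCb i x hx)
      congr 1
      have := gram_mixed (ε i) (fun p r => pd r (w p i) x) (fun j r => pd r (v j i) x)
        (fun p l => a p l i x) (fun p l => b p l i x) (fun j l => c j l i x)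
        (fun j l => e j l i x) (fun p l => rfl) r l
      simp only [Fin.sum_univ_add, matId, B, Fin.addCases_left, Fin.addCases_right,
        Fin.castAdd_inj, Fin.natAdd_inj, hcn, (hcn _ _).symm, if_false, zero_add]
      rw [show 2 * ε i ^ 2 * S x (Fin.castAdd k r) (Fin.natAdd d l) = ε i ^ 2 * a r l i x by
        simp only [a]; ring, sub_eq_iff_eq_add', ← this]
      congr 1 <;> refine Finset.sum_congr rfl fun _ _ => by ring
    intro K L
    refine Fin.addCases (fun r => ?_) (fun l => ?_) K <;>
      refine Fin.addCases (fun r' => ?_) (fun m => ?_) L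
    · obtain ⟨C, hC, hCb⟩ := hfour _ (IsTame.sum Finset.univ fun p => (hDw p r).mul (hDw p r'))
      refine ⟨C + 2 * C₀, by positivity, fun i x hx => ?_⟩
      have h1 := hCb i x hx
      have h2 := hG i x hx r r'
      have h3 : |ε i ^ 2 * gramError (fun p r x => S x (Fin.castAdd k p) (Fin.castAdd k r))
          (fun j => v j i) (fun p => w p i) r r' x| ≤ C₀ * E i := by
        rw [abs_mul, abs_of_nonneg (sq_nonneg (ε i))]
        have h4 := mul_le_mul_of_nonneg_left h2 (sq_nonneg (ε i))
        have h5 := mul_le_mul_of_nonneg_left (hE1 i) hC₀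
        linarith
      have := gram_tangential (ε i) (fun p r => pd r (w p i) x) (fun j r => pd r (v j i) x) r r'
      have key : ∑ I, (matId I (Fin.castAdd k r) + ε i * B I (Fin.castAdd k r) i x)
            * (matId I (Fin.castAdd k r') + ε i * B I (Fin.castAdd k r') i x)
          - (matId (Fin.castAdd k r) (Fin.castAdd k r')
            + 2 * ε i ^ 2 * S x (Fin.castAdd k r) (Fin.castAdd k r'))
          = ε i ^ 4 * ∑ p, pd r (w p i) x * pd r' (w p i) x
            - 2 * (ε i ^ 2 * gramError (fun p r x => S x (Fin.castAdd k p) (Fin.castAdd k r))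
          (fun j => v j i) (fun p => w p i) r r' x) := by
        simp only [Fin.sum_univ_add, matId, B, Fin.addCases_left, Fin.addCases_right,
          Fin.castAdd_inj, (hcn _ _).symm, if_false, zero_add, gramError]
        simp only [← mul_assoc, ← pow_two] at this ⊢
        linear_combination this
      rw [key]
      refine (abs_sub _ _).trans ?_
      rw [abs_mul 2, abs_two]
      linarith
    · exact hmix r m
    · obtain ⟨C, hC, hCb⟩ := hmix r' l
      refine ⟨C, hC, fun i x hx => (le_of_eq ?_).trans (hCb i x hx)⟩
      simp only [hSsym x (Fin.natAdd d l), matId, eq_comm (a := Fin.natAdd d l)]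
      congr 2
      refine Finset.sum_congr rfl fun I _ => by ring
    · obtain ⟨C, hC, hCb⟩ := hfour _ (((IsTame.sum Finset.univ fun p =>
        ((ha p l).add (hεt1.mul (hb p l))).mul ((ha p m).add (hεt1.mul (hb p m)))).sub
          (IsTame.sum Finset.univ fun p => ((hDv l p).mul (hb p m)).add
            ((hDv m p).mul (hb p l)))).add (IsTame.sum Finset.univ fun j =>
        ((hc j l).add (hεt1.mul (he j l))).mul ((hc j m).add (hεt1.mul (he j m)))))
      refine ⟨C, hC, fun i x hx => ?_⟩
      refine (le_of_eq ?_).trans (hCb i x hx)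
      congr 1
      have := gram_normal (ε i) (fun j r => pd r (v j i) x)
        (fun p l => a p l i x) (fun p l => b p l i x) (fun j l => c j l i x)
        (fun j l => e j l i x) (fun j l => S x (Fin.natAdd d j) (Fin.natAdd d l))
        (fun _ _ => hSsym x _ _) (fun _ _ => rfl) (fun _ _ => rfl) l m
      simp only [Fin.sum_univ_add, matId, B, Fin.addCases_left, Fin.addCases_right,
        Fin.natAdd_inj, hcn, if_false, zero_add]
      rw [sub_eq_iff_eq_add', ← this]
      congr 1 <;> refine Finset.sum_congr rfl fun _ _ => by ring
  obtain ⟨CB, hCB, hBb⟩ := exists_common_bound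
    (p := fun (IK : Fin (d + k) × Fin (d + k)) C => ∀ i, ∀ x ∈ ω, |B IK.1 IK.2 i x| ≤ C)
    (fun _ _ _ hle hp i x hx => (hp i x hx).trans hle) fun IK => (hB IK.1 IK.2).bound
  obtain ⟨CD, hCD, hDb⟩ := exists_common_bound
    (p := fun (IK : (Fin (d + k) × Fin (d + k)) × Fin d) C =>
      ∀ i, ∀ x ∈ ω, |pd IK.2 (B IK.1.1 IK.1.2 i) x| ≤ C * τ i)
    (fun _ _ _ hle hp i x hx => (hp i x hx).trans
      (mul_le_mul_of_nonneg_right hle (zero_le_one.trans (hτ i))))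
    fun IK => (hB IK.1.1 IK.1.2).pd_bound IK.2
  obtain ⟨CG, hCG, hGb⟩ := exists_common_bound
    (p := fun (KL : Fin (d + k) × Fin (d + k)) C => ∀ i, ∀ x ∈ ω,
      |∑ I, (matId I KL.1 + ε i * B I KL.1 i x) * (matId I KL.2 + ε i * B I KL.2 i x)
        - (matId KL.1 KL.2 + 2 * ε i ^ 2 * S x KL.1 KL.2)| ≤ C * E i)
    (fun _ _ _ hle hp i x hx => (hp i x hx).trans (mul_le_mul_of_nonneg_right hle (hE0 i)))
    fun KL => hgram KL.1 KL.2
  let Z : ℝ := k * CD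
  have hZ0 : 0 ≤ Z := by positivity
  refine ⟨CB + Z + CG + (d + k : ℕ) * (2 * (1 + CB) * Z + Z * Z), fun i =>
    ⟨filmMap (Y i) (N i), contDiff_filmMap (hY i) (hN i), fun P hP => ?_⟩⟩
  have hE1' : E i ≤ 1 := (hE4 i).trans (hε1 i)
  let ζ : Fin (d + k) → Fin (d + k) → ℝ := fun I K =>
    Fin.addCases (fun r => ∑ l, zpart P l * pd r (N i I l) (xpart P)) (fun _ => 0) K
  have hJ : ∀ I K, matJac (filmMap (Y i) (N i)) P I K
      = matId I K + ε i * B I K i (xpart P) + ζ I K := by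
    intro I K
    rw [matJac_filmMap (hY i) (hN i)]
    refine Fin.addCases (fun r => ?_) (fun l => ?_) K <;>
      simp only [Fin.addCases_left, Fin.addCases_right, hpdY, N, ζ]
  have hz : ∀ l, |zpart P l| ≤ h i := by
    intro l
    have h1 : zpart P l ^ 2 ≤ ∑ j, zpart P j ^ 2 :=
      Finset.single_le_sum (f := fun j => zpart P j ^ 2) (fun j _ => sq_nonneg _)
        (Finset.mem_univ l)
    exact abs_le_of_sq_le_sq (h1.trans hP.2.le) (hh i).le
  have hζ : ∀ I K, |ζ I K| ≤ Z * E i := by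
    intro I K
    refine Fin.addCases (fun r => ?_) (fun l => ?_) K <;>
      simp only [Fin.addCases_left, Fin.addCases_right, ζ]
    · refine (Finset.abs_sum_le_sum_abs _ _).trans ?_
      have : ∀ l ∈ Finset.univ, |zpart P l * pd r (N i I l) (xpart P)| ≤ CD * E i := by
        intro l _
        rw [hpdN, abs_mul, abs_mul, abs_of_pos (hε0 i)]
        have h1 := hDb ((I, Fin.natAdd d l), r) i (xpart P) hP.1
        calc |zpart P l| * (ε i * |pd r (B I (Fin.natAdd d l) i) (xpart P)|)
            ≤ h i * (ε i * (CD * τ i)) :=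
              mul_le_mul (hz l) (mul_le_mul_of_nonneg_left h1 (hε0 i).le)
                (mul_nonneg (hε0 i).le (abs_nonneg _)) (hh i).le
          _ = CD * (h i * ε i * τ i) := by ring
          _ ≤ CD * E i := mul_le_mul_of_nonneg_left (hE3 i) hCD
      refine (Finset.sum_le_sum this).trans ?_
      simp [Z, mul_assoc]
    · rw [abs_zero]
      exact mul_nonneg hZ0 (hE0 i)
  have hεB : ∀ I K, |ε i * B I K i (xpart P)| ≤ CB * ε i := by
    intro I K
    rw [abs_mul, abs_of_pos (hε0 i), mul_comm]
    exact mul_le_mul_of_nonneg_right (hBb (I, K) i _ hP.1) (hε0 i).le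
  refine ⟨fun I K => ?_, fun K L => ?_⟩
  · have h1 : matJac (filmMap (Y i) (N i)) P I K - matId I K
        = ε i * B I K i (xpart P) + ζ I K := by
      rw [hJ]
      ring
    rw [h1]
    refine (abs_add_le _ _).trans ((add_le_add (hεB I K) (hζ I K)).trans ?_)
    have h2 := mul_le_mul_of_nonneg_left (hE4 i) hZ0
    have h3 : 0 ≤ (CG + (d + k : ℕ) * (2 * (1 + CB) * Z + Z * Z)) * ε i := by
      have := hε0 i
      positivity
    linarith
  · have hX : ∀ K I, |matId I K + ε i * B I K i (xpart P)| ≤ 1 + CB := by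
      intro K I
      refine (abs_add_le _ _).trans (add_le_add ?_ ((hεB I K).trans
        (mul_le_of_le_one_right hCB (hε1 i))))
      unfold matId
      split_ifs <;> simp
    have h1 := abs_sum_perturbed_mul_sub_le (by positivity) (hX K) (hX L) (fun I => hζ I K)
      (fun I => hζ I L)
    have h2 := hGb (K, L) i (xpart P) hP.1
    simp only [hJ]
    have h3 : (Z * E i) * (Z * E i) ≤ Z * Z * E i := by
      have := mul_le_mul_of_nonneg_left hE1' (mul_nonneg (mul_nonneg hZ0 hZ0) (hE0 i))
      linarith
    have h4 : ((d + k : ℕ) : ℝ) * (2 * (1 + CB) * (Z * E i) + (Z * E i) * (Z * E i))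
        ≤ (d + k : ℕ) * (2 * (1 + CB) * Z + Z * Z) * E i :=
      calc _ ≤ ((d + k : ℕ) : ℝ) * ((2 * (1 + CB) * Z + Z * Z) * E i) :=
            mul_le_mul_of_nonneg_left (by linarith) (Nat.cast_nonneg _)
        _ = _ := by ring
    have h5 : 0 ≤ (CB + Z) * E i := mul_nonneg (by positivity) (hE0 i)
    refine (abs_sub_le _ (∑ I, (matId I K + ε i * B I K i (xpart P))
      * (matId I L + ε i * B I L i (xpart P))) _).trans ((add_le_add h1 h2).trans ?_)
    linarith

theorem exists_smooth_cutoff {d : ℕ} {ω : Set (Fin d → ℝ)} (hω : Bornology.IsBounded ω) :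
    ∃ χ : (Fin d → ℝ) → ℝ, ContDiff ℝ (⊤ : ℕ∞) χ ∧ HasCompactSupport χ ∧ ∀ x ∈ ω, χ x = 1 := by
  obtain ⟨r, hr, hωr⟩ := hω.subset_closedBall_lt 0 0
  let χ : ContDiffBump (0 : Fin d → ℝ) := ⟨r, r + 1, hr, lt_add_one r⟩
  exact ⟨χ, χ.contDiff, χ.hasCompactSupport, fun x hx => χ.one_of_mem_closedBall (hωr hx)⟩

theorem exists_corrugation_exponent {b γ s κ c : ℝ} {k D : ℕ} (hκ : 0 < κ) (hc : 0 ≤ c)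
    (hDc : D * c = s / 2) (hb : κ * (s / 2) + b / 2 < 1 + γ / 4) :
    ∃ N : ℕ, 0 < N ∧ κ / N * ((N * D + 2 * k) * c + 1 / 2) + b / 2 ≤ 1 + γ / 4 := by
  obtain ⟨N, hN⟩ := exists_nat_gt
    (κ * (2 * k * c + 1 / 2) / (1 + γ / 4 - κ * (s / 2) - b / 2))
  have hδ : 0 < 1 + γ / 4 - κ * (s / 2) - b / 2 := by linarith
  have hN0 : (0 : ℝ) < N := lt_of_le_of_lt (by positivity) hN
  refine ⟨N, by exact_mod_cast hN0, ?_⟩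
  have h1 : κ / N * ((N * D + 2 * k) * c + 1 / 2)
      = κ * (s / 2) + κ * (2 * k * c + 1 / 2) / N := by
    rw [← hDc]
    field_simp
    ring
  have h2 : κ * (2 * k * c + 1 / 2) / N ≤ 1 + γ / 4 - κ * (s / 2) - b / 2 := by
    rw [div_le_iff₀ hN0]
    rw [div_lt_iff₀ hδ] at hN
    linarith
  linarith

theorem exists_deformation_metric_bound {d k : ℕ} (hd : 1 ≤ d) (hk : 1 ≤ k)
    {ω : Set (Fin d → ℝ)} (hωbd : Bornology.IsBounded ω) {s : ℝ}
    (hs : (d : ℝ) * (d + 1) ≤ k * s) (hs0 : 0 ≤ s)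
    {S : (Fin d → ℝ) → Fin (d + k) → Fin (d + k) → ℝ}
    (hS : ContDiff ℝ (⊤ : ℕ∞) S) (hSsym : ∀ x i j, S x i j = S x j i)
    {γ b : ℝ} (hγb : γ < b) (hb2 : b ≤ 2 * γ) (hb : b * (2 + s) < 4 + γ * (1 + s)) :
    ∃ A, ∀ h, 0 < h → h < 1 → ∃ u : (Fin (d + k) → ℝ) → Fin (d + k) → ℝ,
      ContDiff ℝ (⊤ : ℕ∞) u ∧ ∀ p ∈ thinFilm ω h (k := k),
        (∀ i j, |matJac u p i j - matId i j| ≤ A * h ^ (γ / 4)) ∧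
        ∀ i j, |∑ l, matJac u p l i * matJac u p l j - prestrain S γ h (xpart p) i j|
          ≤ A * h ^ (b / 2) := by
  obtain ⟨χ, hχ, hχc, hχ1⟩ := exists_smooth_cutoff hωbd
  have hd0 : (0 : ℝ) < d := by exact_mod_cast hd
  have hD : ((d * (d + 1) / 2 : ℕ) : ℝ) = d * (d + 1) / 2 := by
    rw [Nat.cast_div (even_iff_two_dvd.1 (Nat.even_mul_succ_self d)) two_ne_zero]
    push_cast
    ring
  let c : ℝ := s / (d * (d + 1))
  let κ : ℝ := (b - γ) / 2
  have hc : 0 ≤ c := by positivity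
  have hkc : 1 ≤ k * c := by
    rw [← mul_div_assoc, one_le_div (by positivity)]
    exact hs
  have hDc : ((d * (d + 1) / 2 : ℕ) : ℝ) * c = s / 2 := by
    rw [hD]
    simp only [c]
    field_simp
  have hκ : 0 < κ := half_pos (sub_pos.2 hγb)
  obtain ⟨N, hN, hexp⟩ := exists_corrugation_exponent (b := b) (γ := γ) (k := k) hκ hc hDc
    (by simp only [κ]; linarith)
  have hN0 : (0 : ℝ) < N := by exact_mod_cast hN
  set M : ℝ := (N * (d * (d + 1) / 2 : ℕ) + 2 * k) * c + 1 / 2 with hM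
  have hM0 : 0 ≤ M := by positivity
  let ι := {h : ℝ // 0 < h ∧ h < 1}
  let σ : ι → ℝ := fun h => h.1 ^ (-(κ / N))
  let τ : ι → ℝ := fun h => σ h ^ M
  have hσ : ∀ i, 1 ≤ σ i := fun i =>
    one_le_rpow_of_pos_of_le_one_of_nonpos i.2.1 i.2.2.le (neg_nonpos.2 (by positivity))
  have hτ : ∀ i, 1 ≤ τ i := fun i => one_le_rpow (hσ i) hM0
  have hScomp : ∀ K L, ContDiff ℝ (⊤ : ℕ∞) (fun x => S x K L) := fun K L =>
    contDiff_pi.1 (contDiff_pi.1 hS K) L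
  obtain ⟨v, w, C, hC, hv, hw, hbound⟩ := exists_displacement (σ := σ) (c := c)
    (T := fun p r x => χ x * S x (Fin.castAdd k p) (Fin.castAdd k r)) hσ hk hc hkc
    (fun p r => by simp only [hSsym _ (Fin.castAdd k p)])
    (fun p r => .of_hasCompactSupport (hχ.mul (hScomp _ _)) hχc.mul_right) N
  have hDv : ∀ j r, IsTame ω τ (fun i => pd r (v j i)) := fun j r =>
    ⟨fun i => contDiff_pd (hv j i) r, ⟨C, hC, fun i x _ => (hbound i x).2.1 j r⟩,
      fun r' => ⟨C, hC, fun i x _ => (hbound i x).2.2.2.1 j r r'⟩⟩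
  have hDw : ∀ p r, IsTame ω τ (fun i => pd r (w p i)) := fun p r =>
    ⟨fun i => contDiff_pd (hw p i) r, ⟨C, hC, fun i x _ => (hbound i x).2.2.1 p r⟩,
      fun r' => ⟨C, hC, fun i x _ => (hbound i x).2.2.2.2 p r r'⟩⟩
  have hmono : ∀ (i : ι) {x y : ℝ}, y ≤ x → i.1 ^ x ≤ i.1 ^ y := fun i _ _ hxy =>
    rpow_le_rpow_of_exponent_ge i.2.1 i.2.2.le hxy
  have hpow : ∀ (i : ι) (n : ℕ), (i.1 ^ (γ / 4)) ^ n = i.1 ^ (γ / 4 * n) := fun i n => by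
    rw [rpow_mul i.2.1.le, rpow_natCast]
  obtain ⟨A, hA⟩ := exists_film_deformation (ω := ω) (τ := τ) hωbd hτ hS hSsym hv hw hDv hDw
    (h := fun i => i.1) (ε := fun i => i.1 ^ (γ / 4)) (E := fun i => i.1 ^ (b / 2))
    (ρ := fun i => σ i ^ (-(N : ℝ))) (fun i => i.2.1) (fun i => rpow_pos_of_pos i.2.1 _)
    (fun i => rpow_le_one i.2.1.le i.2.2.le (by linarith)) hC
    (fun i x hx p r => by
      have := (hbound i x).1 p r
      simpa only [gramError, hχ1 x hx, one_mul] using this)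
    (fun i => by
      rw [hpow, ← rpow_mul i.2.1.le, ← rpow_add i.2.1]
      refine hmono i (le_of_eq ?_)
      simp only [κ]
      field_simp
      push_cast
      ring)
    (fun i => by
      rw [hpow]
      refine hmono i ?_
      push_cast
      linarith)
    (fun i => by
      simp only [τ, σ]
      rw [← rpow_mul i.2.1.le, ← rpow_one_add' i.2.1.le (by linarith), ← rpow_add i.2.1]
      refine hmono i ?_
      linarith)
    (fun i => hmono i (by linarith))
  refine ⟨A, fun h h0 h1 => ?_⟩
  obtain ⟨u, hu, hub⟩ := hA ⟨h, h0, h1⟩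
  refine ⟨u, hu, fun P hP => ⟨(hub P hP).1, fun K L => ?_⟩⟩
  have := (hub P hP).2 K L
  rw [hpow] at this
  have hγ2 : γ / 4 * (2 : ℕ) = γ / 2 := by
    push_cast
    ring
  rw [hγ2] at this
  exact this

theorem matJac_id {n : ℕ} (p : Fin n → ℝ) : matJac (fun y => y) p = matId := by
  funext i j
  exact pd_coord i j

theorem exists_abs_id_metric_sub_prestrain_le {d k : ℕ} {ω : Set (Fin d → ℝ)}
    (hωbd : Bornology.IsBounded ω) {S : (Fin d → ℝ) → Fin (d + k) → Fin (d + k) → ℝ}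
    (hS : Continuous S) (γ : ℝ) :
    ∃ A, ∀ h, 0 < h → ∀ p ∈ thinFilm ω h (k := k),
      (∀ i j, |matJac (fun y => y) p i j - matId i j| ≤ A * h ^ (1 : ℝ)) ∧
      ∀ i j, |∑ l, matJac (fun y => y) p l i * matJac (fun y => y) p l j
        - prestrain S γ h (xpart p) i j| ≤ A * h ^ (γ / 2) := by
  obtain ⟨B, hB⟩ := hωbd.isCompact_closure.exists_bound_of_continuousOn hS.continuousOn
  refine ⟨2 * |B|, fun h hh p hp => ?_⟩
  have hpos : 0 ≤ h ^ (γ / 2) := rpow_nonneg hh.le _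
  rw [matJac_id]
  refine ⟨fun i j => ?_, fun i j => ?_⟩
  · rw [sub_self, abs_zero]
    positivity
  · have h1 : ∑ l, (matId l i : ℝ) * matId l j = matId i j := by
      simp [matId, eq_comm]
    have h2 : |S (xpart p) i j| ≤ |B| :=
      ((norm_le_pi_norm (S (xpart p) i) j).trans (norm_le_pi_norm (S (xpart p)) i)).trans
        ((hB _ (subset_closure hp.1)).trans (le_abs_self B))
    rw [h1, prestrain, sub_add_cancel_left, abs_neg, abs_mul, abs_mul, abs_two, abs_of_nonneg hpos]
    have := mul_le_mul_of_nonneg_left h2 hpos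
    linarith

/-- Theorem 1.13: energy scaling bounds in the quantitative immersability of the
Riemannian metrics `g^h = Id + 2h^{γ/2}S` on thin films `Ω^h = ω × B(0,h)`,
with `s = d(d+1)/k` (and `s = 1` when `k ≥ d(d+1)`). -/
theorem energy_scaling_thin_films
    {d k : ℕ} (hd : 1 ≤ d) (hk : 1 ≤ k)
    (ω : Set (Fin d → ℝ)) (hω : IsOpen ω) (hωbd : Bornology.IsBounded ω)
    (hωne : ω.Nonempty)
    (s : ℝ) (hs : s = if d * (d + 1) ≤ k then 1 else (d : ℝ) * ((d : ℝ) + 1) / (k : ℝ))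
    (S : (Fin d → ℝ) → Fin (d + k) → Fin (d + k) → ℝ)
    (hS : ContDiff ℝ (⊤ : ℕ∞) S) (hSsym : ∀ x i j, S x i j = S x j i)
    (γ : ℝ) (hγ : 0 < γ)
    (W : (Fin (d + k) → Fin (d + k) → ℝ) → ℝ≥0∞)
    (hW0 : W matId = 0)
    (hWframe : ∀ R ∈ SOset (d + k), ∀ F, W (matMul R F) = W F)
    (hWreg : ∃ U : Set (Fin (d + k) → Fin (d + k) → ℝ), IsOpen U ∧ SOset (d + k) ⊆ U ∧
        (∀ F ∈ U, W F ≠ ⊤) ∧ ContDiffOn ℝ 2 (fun F => (W F).toReal) U) :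
    -- (i) the regime γ ≥ 4
    ((4 ≤ γ) → ∀ b : ℝ, b < 2 + γ / 2 →
      ∃ C : ℝ, 0 < C ∧ ∃ h₀ : ℝ, 0 < h₀ ∧ ∀ h : ℝ, 0 < h → h < h₀ →
        (∃ R, IsInvSqrt ω S γ h R) ∧
        ∃ u : (Fin (d + k) → ℝ) → Fin (d + k) → ℝ, ContDiff ℝ (⊤ : ℕ∞) u ∧
          ∀ R, IsInvSqrt ω S γ h R →
            energy ω h W u R ≤ ENNReal.ofReal (C * h ^ b))
    ∧
    -- (ii) the regime 4/(3+s) ≤ γ < 4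
    ((4 / (3 + s) ≤ γ ∧ γ < 4) → ∀ b : ℝ, b < (4 + γ * (1 + s)) / (2 + s) →
      ∃ C : ℝ, 0 < C ∧ ∃ h₀ : ℝ, 0 < h₀ ∧ ∀ h : ℝ, 0 < h → h < h₀ →
        (∃ R, IsInvSqrt ω S γ h R) ∧
        ∃ u : (Fin (d + k) → ℝ) → Fin (d + k) → ℝ, ContDiff ℝ (⊤ : ℕ∞) u ∧
          ∀ R, IsInvSqrt ω S γ h R →
            energy ω h W u R ≤ ENNReal.ofReal (C * h ^ b))
    ∧
    -- (iii) the regime 0 < γ < 4/(3+s), with β = 2γ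
    ((γ < 4 / (3 + s)) →
      ∃ C : ℝ, 0 < C ∧ ∃ h₀ : ℝ, 0 < h₀ ∧ ∀ h : ℝ, 0 < h → h < h₀ →
        (∃ R, IsInvSqrt ω S γ h R) ∧
        ∃ u : (Fin (d + k) → ℝ) → Fin (d + k) → ℝ, ContDiff ℝ (⊤ : ℕ∞) u ∧
          ∀ R, IsInvSqrt ω S γ h R →
            energy ω h W u R ≤ ENNReal.ofReal (C * h ^ (2 * γ))) := by
  have hd0 : (0 : ℝ) < d := by exact_mod_cast hd
  have hk0 : (0 : ℝ) < k := by exact_mod_cast hk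
  have hs0 : 0 < s := by
    rw [hs]
    split_ifs <;> positivity
  have hks : (d : ℝ) * (d + 1) ≤ k * s := by
    rw [hs]
    split_ifs with hdk
    · rw [mul_one]
      exact_mod_cast hdk
    · rw [mul_div_cancel₀ _ hk0.ne']
  have hflat : ∀ b ≤ γ, ∃ C : ℝ, 0 < C ∧ ∃ h₀ : ℝ, 0 < h₀ ∧ ∀ h : ℝ, 0 < h → h < h₀ →
        (∃ R, IsInvSqrt ω S γ h R) ∧
        ∃ u : (Fin (d + k) → ℝ) → Fin (d + k) → ℝ, ContDiff ℝ (⊤ : ℕ∞) u ∧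
          ∀ R, IsInvSqrt ω S γ h R →
            energy ω h W u R ≤ ENNReal.ofReal (C * h ^ b) := by
    intro b hb
    obtain ⟨A, hA⟩ := exists_abs_id_metric_sub_prestrain_le hωbd hS.continuous γ
    exact exists_energy_bound_of_metric_bound hω hωbd hS.continuous hSsym hγ hW0 hWframe hWreg
      (half_pos hγ) one_pos (by linarith) one_pos fun h h0 _ => ⟨fun y => y, contDiff_id, hA h h0⟩
  have hcorr : ∀ b, b ≤ 2 * γ → b * (2 + s) < 4 + γ * (1 + s) →
      ∃ C : ℝ, 0 < C ∧ ∃ h₀ : ℝ, 0 < h₀ ∧ ∀ h : ℝ, 0 < h → h < h₀ →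
        (∃ R, IsInvSqrt ω S γ h R) ∧
        ∃ u : (Fin (d + k) → ℝ) → Fin (d + k) → ℝ, ContDiff ℝ (⊤ : ℕ∞) u ∧
          ∀ R, IsInvSqrt ω S γ h R →
            energy ω h W u R ≤ ENNReal.ofReal (C * h ^ b) := by
    intro b hb2 hb
    rcases le_or_gt b γ with hbγ | hbγ
    · exact hflat b hbγ
    · obtain ⟨A, hA⟩ := exists_deformation_metric_bound hd hk hωbd hks hs0.le hS hSsym hbγ hb2 hb
      exact exists_energy_bound_of_metric_bound hω hωbd hS.continuous hSsym hγ hW0 hWframe hWreg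
        (by linarith) (by linarith) (by linarith) one_pos hA
  refine ⟨fun hγ4 b hb => hflat b (by linarith), fun hγ' b hb => ?_, fun hγ' => ?_⟩
  · rw [lt_div_iff₀ (by linarith)] at hb
    have h1 := (div_le_iff₀ (by linarith)).1 hγ'.1
    refine hcorr b ?_ hb
    by_contra! hlt
    have := mul_lt_mul_of_pos_right hlt (show 0 < 2 + s by linarith)
    linarith
  · rw [lt_div_iff₀ (by linarith)] at hγ'
    exact hcorr (2 * γ) le_rfl (by linarith)
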